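/- arXiv:math/9805136 — 16 statements merged into one kernel-verified Lean document; each statement's English description precedes it below -/
import Mathlib

section
/- (Napoleon's Theorem) Let A, B, C be three points in the Euclidean plane forming a triangle. Erect an equilateral triangle externally on each side of triangle ABC, and let N₁, N₂, N₃ be the circumcenters of the equilateral triangles erected on sides AB, BC, and CA respectively. Then the triangle N₁N₂N₃ is equilateral, i.e. dist(N₁,N₂) = dist(N₂,N₃) = dist(N₃,N₁). -/
open scoped RealInnerProductSpace

/-- The planar cross product of two vectors in `ℂ ≅ ℝ²`. -/
def cross (z w : ℂ) : ℝ := z.re * w.im - z.im * w.re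

theorem dist_eq_dist_iff_sq (x y z w : ℂ) :
    dist x y = dist z w ↔
      (x.re - y.re) ^ 2 + (x.im - y.im) ^ 2 = (z.re - w.re) ^ 2 + (z.im - w.im) ^ 2 := by
  rw [Complex.dist_eq_re_im, Complex.dist_eq_re_im, Real.sqrt_inj (by positivity) (by positivity)]

/-- In coordinates with `P` at the origin, `Q = (x, y)` and the apex `T = (u, v)` on the side
of `PQ` selected by the sign of `s = ±√3`, the circumcenter `(a, b)` is determined. -/
theorem circumcenter_coords {s x y u v a b : ℝ} (hs : s ^ 2 = 3)
    (hside : s * (x * v - y * u) < 0)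
    (hP : u ^ 2 + v ^ 2 = x ^ 2 + y ^ 2)
    (hQ : (u - x) ^ 2 + (v - y) ^ 2 = x ^ 2 + y ^ 2)
    (hNQ : a ^ 2 + b ^ 2 = (a - x) ^ 2 + (b - y) ^ 2)
    (hNT : a ^ 2 + b ^ 2 = (a - u) ^ 2 + (b - v) ^ 2) :
    a = x / 2 + s / 6 * y ∧ b = y / 2 - s / 6 * x := by
  have hdot : 2 * (u * x + v * y) = x ^ 2 + y ^ 2 := by linarith
  have hL : 0 < x ^ 2 + y ^ 2 := by
    by_contra! h
    have hx : x = 0 := by nlinarith [sq_nonneg x, sq_nonneg y]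
    have hy : y = 0 := by nlinarith [sq_nonneg x, sq_nonneg y]
    simp [hx, hy] at hside
  have hprod : (2 * (x * v - y * u) - s * (x ^ 2 + y ^ 2)) *
      (2 * (x * v - y * u) + s * (x ^ 2 + y ^ 2)) = 0 := by
    linear_combination 4 * (x ^ 2 + y ^ 2) * hP
      - (2 * (u * x + v * y) + (x ^ 2 + y ^ 2)) * hdot - (x ^ 2 + y ^ 2) ^ 2 * hs
  have hcross : 2 * (x * v - y * u) + s * (x ^ 2 + y ^ 2) = 0 := by
    refine (mul_eq_zero.mp hprod).resolve_left fun h => ?_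
    have h3 : 2 * (s * (x * v - y * u)) = 3 * (x ^ 2 + y ^ 2) := by
      linear_combination s * h + (x ^ 2 + y ^ 2) * hs
    linarith
  have hu : u = (x + s * y) / 2 := by
    apply mul_left_cancel₀ hL.ne'
    linear_combination x / 2 * hdot - y / 2 * hcross
  have hv : v = (y - s * x) / 2 := by
    apply mul_left_cancel₀ hL.ne'
    linear_combination y / 2 * hdot + x / 2 * hcross
  have h1 : 2 * (a * x + b * y) = x ^ 2 + y ^ 2 := by linarith
  have h2 : 2 * (a * u + b * v) = x ^ 2 + y ^ 2 := by linarith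
  have h3 : a * y - b * x = s * (x ^ 2 + y ^ 2) / 6 := by
    rw [hu, hv] at h2
    linear_combination s / 3 * h2 - s / 6 * h1 - (a * y - b * x) / 3 * hs
  constructor <;> apply mul_left_cancel₀ hL.ne'
  · linear_combination x / 2 * h1 + y * h3
  · linear_combination y / 2 * h1 - x * h3

theorem circumcenter_erected {s : ℝ} {P Q T N : ℂ} (hs : s ^ 2 = 3)
    (hside : s * cross (Q - P) (T - P) < 0)
    (hT : dist T P = dist P Q ∧ dist T Q = dist P Q)
    (hN : dist N P = dist N Q ∧ dist N P = dist N T) :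
    N.re = (P.re + Q.re) / 2 + s / 6 * (Q.im - P.im) ∧
      N.im = (P.im + Q.im) / 2 - s / 6 * (Q.re - P.re) := by
  simp only [dist_eq_dist_iff_sq] at hT hN
  simp only [cross, Complex.sub_re, Complex.sub_im] at hside
  obtain ⟨h1, h2⟩ := circumcenter_coords (a := N.re - P.re) (b := N.im - P.im) hs hside
    (by linarith [hT.1]) (by linarith [hT.2]) (by linarith [hN.1]) (by linarith [hN.2])
  constructor <;> linarith

/-- The sign of a nonzero real, scaled to have square `3`. -/
theorem exists_sq_eq_three_of_ne_zero {k : ℝ} (hk : k ≠ 0) :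
    ∃ s : ℝ, s ^ 2 = 3 ∧ ∀ c, c * k < 0 → s * c < 0 := by
  have h3 : 0 < √3 := by positivity
  rcases hk.lt_or_gt with h | h
  · refine ⟨-√3, by simp, fun c hc => ?_⟩
    have : 0 < c := pos_of_mul_neg_left hc h.le
    nlinarith
  · refine ⟨√3, by simp, fun c hc => ?_⟩
    have : c < 0 := neg_of_mul_neg_left hc h.le
    nlinarith

/-- **Napoleon's Theorem.** If equilateral triangles are erected externally on the
sides of a triangle `ABC` (apexes `T₁, T₂, T₃` on sides `AB, BC, CA`, each on the
opposite side of the corresponding side line from the remaining vertex), then their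
circumcenters `N₁, N₂, N₃` form an equilateral triangle. -/
theorem napoleon (A B C T₁ T₂ T₃ N₁ N₂ N₃ : ℂ)
    (hABC : ¬ Collinear ℝ ({A, B, C} : Set ℂ))
    -- `T₁` is the apex of the equilateral triangle erected on side `AB`,
    (hT₁ : dist T₁ A = dist A B ∧ dist T₁ B = dist A B)
    -- on the opposite side of line `AB` from `C`:
    (hT₁ext : cross (B - A) (T₁ - A) * cross (B - A) (C - A) < 0)
    -- `T₂` is the apex of the equilateral triangle erected on side `BC`,
    (hT₂ : dist T₂ B = dist B C ∧ dist T₂ C = dist B C)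
    (hT₂ext : cross (C - B) (T₂ - B) * cross (C - B) (A - B) < 0)
    -- `T₃` is the apex of the equilateral triangle erected on side `CA`,
    (hT₃ : dist T₃ C = dist C A ∧ dist T₃ A = dist C A)
    (hT₃ext : cross (A - C) (T₃ - C) * cross (A - C) (B - C) < 0)
    -- `N₁` is the circumcenter of the equilateral triangle `A B T₁`:
    (hN₁ : dist N₁ A = dist N₁ B ∧ dist N₁ A = dist N₁ T₁)
    -- `N₂` is the circumcenter of the equilateral triangle `B C T₂`:
    (hN₂ : dist N₂ B = dist N₂ C ∧ dist N₂ B = dist N₂ T₂)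
    -- `N₃` is the circumcenter of the equilateral triangle `C A T₃`:
    (hN₃ : dist N₃ C = dist N₃ A ∧ dist N₃ C = dist N₃ T₃) :
    dist N₁ N₂ = dist N₂ N₃ ∧ dist N₂ N₃ = dist N₃ N₁ := by
  obtain ⟨s, hs, hneg⟩ := exists_sq_eq_three_of_ne_zero (right_ne_zero_of_mul hT₁ext.ne)
  have hB : cross (C - B) (A - B) = cross (B - A) (C - A) := by
    simp only [cross, Complex.sub_re, Complex.sub_im]; ring
  have hC : cross (A - C) (B - C) = cross (B - A) (C - A) := by
    simp only [cross, Complex.sub_re, Complex.sub_im]; ring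
  rw [hB] at hT₂ext
  rw [hC] at hT₃ext
  obtain ⟨r₁, i₁⟩ := circumcenter_erected hs (hneg _ hT₁ext) hT₁ hN₁
  obtain ⟨r₂, i₂⟩ := circumcenter_erected hs (hneg _ hT₂ext) hT₂ hN₂
  obtain ⟨r₃, i₃⟩ := circumcenter_erected hs (hneg _ hT₃ext) hT₃ hN₃
  simp only [dist_eq_dist_iff_sq, r₁, i₁, r₂, i₂, r₃, i₃]
  constructor
  · linear_combination (((A.re - 2 * B.re + C.re) ^ 2 + (A.im - 2 * B.im + C.im) ^ 2
      - (B.re - 2 * C.re + A.re) ^ 2 - (B.im - 2 * C.im + A.im) ^ 2) / 36) * hs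
  · linear_combination (((B.re - 2 * C.re + A.re) ^ 2 + (B.im - 2 * C.im + A.im) ^ 2
      - (C.re - 2 * A.re + B.re) ^ 2 - (C.im - 2 * A.im + B.im) ^ 2) / 36) * hs
end

section
/- (Morley's Theorem) Let ABC be a non-degenerate triangle in the Euclidean plane. For each vertex, trisect the interior angle; for each side of the triangle, the two trisectors adjacent to that side (one from each of the side's endpoints) meet at a point. Let P, Q, R be the three points obtained in this way from the three sides. Then triangle PQR is equilateral. -/
open EuclideanGeometry

/-- Twice the signed area of the triangle `XYZ`. -/
def signedArea (X Y Z : ℂ) : ℝ :=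
  (Y - X).re * (Z - X).im - (Y - X).im * (Z - X).re

lemma signedArea_rotate (X Y Z : ℂ) : signedArea Y Z X = signedArea X Y Z := by
  simp only [signedArea, Complex.sub_re, Complex.sub_im]; ring

lemma signedArea_swap (X Y Z : ℂ) : signedArea X Z Y = -signedArea X Y Z := by
  simp only [signedArea, Complex.sub_re, Complex.sub_im]; ring

lemma signedArea_ne_zero {X Y Z : ℂ} (h : ¬ Collinear ℝ ({X, Y, Z} : Set ℂ)) :
    signedArea X Y Z ≠ 0 := by
  intro h0
  apply h
  have hXY : Y - X ≠ 0 := by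
    intro hYX
    rw [sub_eq_zero.mp hYX] at h
    exact h (by simpa using collinear_pair ℝ X Z)
  rw [collinear_iff_of_mem (p₀ := X) (by simp)]
  refine ⟨Y - X, ?_⟩
  have hn : Complex.normSq (Y - X) ≠ 0 := by simpa using hXY
  simp only [Set.mem_insert_iff, Set.mem_singleton_iff, forall_eq_or_imp, forall_eq]
  refine ⟨⟨0, by simp⟩, ⟨1, by simp⟩,
    ((Y - X).re * (Z - X).re + (Y - X).im * (Z - X).im) / Complex.normSq (Y - X), ?_⟩
  have hZ : Z - X = (((Y - X).re * (Z - X).re + (Y - X).im * (Z - X).im) /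
      Complex.normSq (Y - X) : ℝ) * (Y - X) := by
    unfold signedArea at h0
    rw [Complex.normSq_apply] at hn ⊢
    generalize Y - X = u at *
    generalize Z - X = v at *
    apply Complex.ext
    · rw [Complex.re_ofReal_mul]
      rw [div_mul_eq_mul_div, eq_div_iff hn]
      linear_combination (-u.im) * h0
    · rw [Complex.im_ofReal_mul]
      rw [div_mul_eq_mul_div, eq_div_iff hn]
      linear_combination u.re * h0
  simp only [vadd_eq_add, Complex.real_smul]
  rw [← hZ]; ring

lemma signedArea_pos_of_sSameSide {X Y Z W : ℂ}
    (h : (affineSpan ℝ ({X, Y} : Set ℂ)).SSameSide W Z) (hZ : 0 < signedArea X Y Z) :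
    0 < signedArea X Y W := by
  rw [AffineSubspace.sSameSide_iff_exists_left (left_mem_affineSpan_pair ℝ X Y)] at h
  obtain ⟨hWs, hZs, p, hp, hray⟩ := h
  obtain ⟨t, rfl⟩ := mem_affineSpan_pair_iff_exists_lineMap_eq.mp hp
  obtain ⟨r, s, hr, hs, hrs⟩ := hray.exists_pos
    (by rw [vsub_eq_sub, sub_ne_zero]; rintro rfl; exact hWs (left_mem_affineSpan_pair ℝ _ _))
    (by rw [vsub_eq_sub, sub_ne_zero]; rintro rfl; exact hZs hp)
  have hre := congrArg Complex.re hrs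
  have him := congrArg Complex.im hrs
  simp [AffineMap.lineMap_apply] at hre him
  have key : r * signedArea X Y W = s * signedArea X Y Z := by
    simp only [signedArea, Complex.sub_re, Complex.sub_im]
    linear_combination (Y.re - X.re) * him - (Y.im - X.im) * hre
  exact pos_of_mul_pos_right (key ▸ mul_pos hs hZ) hr.le

lemma im_div_pos_of_signedArea_pos {X Y Z : ℂ} (h : 0 < signedArea X Y Z) :
    0 < ((Z - X) / (Y - X)).im := by
  have hXY : Y - X ≠ 0 := by
    intro h0
    simp [signedArea, h0] at h
  have hn : 0 < Complex.normSq (Y - X) := Complex.normSq_pos.mpr hXY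
  rw [Complex.div_im, ← sub_div]
  apply div_pos _ hn
  unfold signedArea at h
  linarith

/-- The angles at `X` and `Y` of a positively oriented triangle `XYZ` determine `Z`. -/
lemma sub_mul_sin_add_angle {X Y Z : ℂ} (h : 0 < signedArea X Y Z) :
    0 < ∠ Z X Y ∧ (Z - X) * Real.sin (∠ Z X Y + ∠ Z Y X) =
      (Y - X) * Real.sin (∠ Z Y X) * Complex.exp (∠ Z X Y * Complex.I) := by
  have hw := im_div_pos_of_signedArea_pos h
  have hYX : Y - X ≠ 0 := by
    intro h0
    simp [signedArea, h0] at h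
  have hXY : X - Y ≠ 0 := fun h0 => hYX (by linear_combination -h0)
  set w := (Z - X) / (Y - X) with hwdef
  have hZX : Z - X ≠ 0 := by
    intro h0
    simp [hwdef, h0] at hw
  have h1w : (Z - Y) / (X - Y) = 1 - w := by
    rw [hwdef]; field_simp; grind
  have hZY : Z - Y ≠ 0 := by
    intro h0
    rw [h0, zero_div] at h1w
    have := congrArg Complex.im h1w
    simp at this
    linarith
  have hα : ∠ Z X Y = w.arg := by
    rw [EuclideanGeometry.angle, vsub_eq_sub, vsub_eq_sub, Complex.angle_eq_abs_arg hZX hYX,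
      abs_of_nonneg (Complex.arg_nonneg_iff.mpr hw.le)]
  have hβ : ∠ Z Y X = -(1 - w).arg := by
    rw [EuclideanGeometry.angle, vsub_eq_sub, vsub_eq_sub, Complex.angle_eq_abs_arg hZY hXY,
      h1w, abs_of_neg (Complex.arg_neg_iff.mpr (by simpa using hw))]
  have e1 := Complex.norm_mul_cos_arg w
  have e2 := Complex.norm_mul_sin_arg w
  have e3 := Complex.norm_mul_cos_arg (1 - w)
  have e4 := Complex.norm_mul_sin_arg (1 - w)
  have hpos : 0 < w.arg := by
    refine lt_of_le_of_ne (Complex.arg_nonneg_iff.mpr hw.le) fun h0 => ?_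
    rw [← h0, Real.sin_zero] at e2
    linarith
  rw [hα, hβ]
  refine ⟨hpos, ?_⟩
  have hr : ‖w‖ * Real.sin (w.arg + -(1 - w).arg) = Real.sin (-(1 - w).arg) := by
    simp only [Complex.sub_re, Complex.sub_im, Complex.one_re, Complex.one_im] at e3 e4
    rw [Real.sin_add, Real.cos_neg, Real.sin_neg]
    linear_combination Real.cos (1 - w).arg * e2 - Real.sin (1 - w).arg * e1
      - Real.sin (1 - w).arg * e3 + Real.cos (1 - w).arg * e4
  have hZ : Z - X = (Y - X) * (‖w‖ * Complex.exp (w.arg * Complex.I)) := by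
    rw [Complex.norm_mul_exp_arg_mul_I, hwdef, mul_div_cancel₀ _ hYX]
  rw [← hr, hZ]
  push_cast
  ring

lemma sin_three_mul_of_add_eq {a b c : ℝ} (h : a + b + c = Real.pi / 3) :
    Real.sin (3 * c) = 4 * Real.sin c * Real.sin (Real.pi / 3 + c) * Real.sin (a + b) := by
  rw [show a + b = Real.pi / 3 - c by linarith, Real.sin_three_mul, Real.sin_add, Real.sin_sub,
    Real.sin_pi_div_three, Real.cos_pi_div_three]
  have h3 : √3 ^ 2 = (3 : ℝ) := by norm_num
  linear_combination (-(Real.sin c * Real.cos c ^ 2)) * h3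
    - 3 * Real.sin c * Real.sin_sq_add_cos_sq c

lemma sin_mul_exp_sub_sin {a b c : ℝ} (h : a + b + c = Real.pi / 3) :
    Real.sin (Real.pi / 3 + b) * Complex.exp (a * Complex.I) - Real.sin (Real.pi / 3 + c) =
      Real.sin a * -Complex.exp ((-(Real.pi / 3 + b) : ℝ) * Complex.I) := by
  have hc : Real.sin (Real.pi / 3 + c) = Real.sin (Real.pi / 3 + b + a) := by
    rw [← Real.sin_pi_sub]; congr 1; linarith
  rw [hc, Real.sin_add (Real.pi / 3 + b), Complex.exp_mul_I, Complex.exp_mul_I]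
  push_cast
  rw [Complex.cos_neg, Complex.sin_neg]
  ring

/-- In a triangle `ABC` with angles `3a, 3b, 3c`, the Morley vertices `Q` and `R` near `A` are at
distance `4 (AB / sin 3c) sin a sin b sin c`. -/
lemma dist_trisector_inter {A B C Q R : ℂ} {a b c : ℝ} (h : 0 < signedArea A B C)
    (ha : 0 < a) (hb : 0 < b) (hc : 0 < c) (habc : a + b + c = Real.pi / 3)
    (hA : ∠ C A B = 3 * a) (hB : ∠ C B A = 3 * b)
    (hQ : 0 < signedArea C A Q) (hQC : ∠ Q C A = c) (hQA : ∠ Q A C = a)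
    (hR : 0 < signedArea A B R) (hRA : ∠ R A B = a) (hRB : ∠ R B A = b) :
    dist Q R * Real.sin (3 * c) =
      4 * Real.sin a * Real.sin b * Real.sin c * dist A B := by
  have hC := (sub_mul_sin_add_angle h).2
  have hR' := (sub_mul_sin_add_angle hR).2
  have hQ' := (sub_mul_sin_add_angle hQ).2
  rw [hA, hB, show 3 * a + 3 * b = Real.pi - 3 * c by linarith, Real.sin_pi_sub] at hC
  rw [hRA, hRB] at hR'
  rw [hQC, hQA] at hQ'
  have hab : (Real.sin (a + b) : ℂ) ≠ 0 := by
    exact_mod_cast (Real.sin_pos_of_pos_of_lt_pi (by linarith) (by linarith [Real.pi_pos])).ne'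
  have hca : (Real.sin (c + a) : ℂ) ≠ 0 := by
    exact_mod_cast (Real.sin_pos_of_pos_of_lt_pi (by linarith) (by linarith [Real.pi_pos])).ne'
  have hsa : 0 < Real.sin a := Real.sin_pos_of_pos_of_lt_pi ha (by linarith [Real.pi_pos])
  have hsb : 0 < Real.sin b := Real.sin_pos_of_pos_of_lt_pi hb (by linarith [Real.pi_pos])
  have hsc : 0 < Real.sin c := Real.sin_pos_of_pos_of_lt_pi hc (by linarith [Real.pi_pos])
  have hs3 : 0 < Real.sin (3 * c) :=
    Real.sin_pos_of_pos_of_lt_pi (by linarith) (by linarith [Real.pi_pos])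
  have h3c : (Real.sin (3 * c) : ℂ) = _ := congrArg Complex.ofReal (sin_three_mul_of_add_eq habc)
  have h3b : (Real.sin (3 * b) : ℂ) = _ := congrArg Complex.ofReal
    (sin_three_mul_of_add_eq (a := c) (b := a) (c := b) (by linarith))
  have hRk : (R - A) * Real.sin (3 * c) = (B - A) * (4 * Real.sin b * Real.sin c *
      Real.sin (Real.pi / 3 + c) * Complex.exp (a * Complex.I)) := by
    rw [h3c]
    push_cast at hR' ⊢
    linear_combination (4 * Complex.sin c * Complex.sin (Real.pi / 3 + c)) * hR'
  have hQA' : (Q - A) * Real.sin (c + a) =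
      (C - A) * (Real.sin c * Complex.exp (-(a * Complex.I))) := by
    have hadd : (Real.sin (c + a) : ℂ) =
        Real.sin c * Complex.exp (-(a * Complex.I)) + Real.sin a * Complex.exp (c * Complex.I) := by
      rw [← neg_mul, ← Complex.ofReal_neg, Complex.exp_mul_I, Complex.exp_mul_I, Real.sin_add]
      push_cast
      rw [Complex.cos_neg, Complex.sin_neg]
      ring
    linear_combination hQ' + (C - A) * hadd
  have hexp : Complex.exp (-(a * Complex.I)) * Complex.exp ((3 * a : ℝ) * Complex.I) =
      Complex.exp (a * Complex.I) * Complex.exp (a * Complex.I) := by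
    rw [← Complex.exp_add, ← Complex.exp_add]
    congr 1; push_cast; ring
  have hQk : (Q - A) * Real.sin (3 * c) = (B - A) * (4 * Real.sin b * Real.sin c *
      Real.sin (Real.pi / 3 + b) *
      (Complex.exp (a * Complex.I) * Complex.exp (a * Complex.I))) := by
    apply mul_right_cancel₀ hca
    rw [← hexp]
    rw [h3b] at hC
    push_cast at hC hQA' ⊢
    linear_combination Complex.sin (3 * c) * hQA' +
      Complex.sin c * Complex.exp (-(a * Complex.I)) * hC
  have hQR : (Q - R) * Real.sin (3 * c) = (B - A) * (4 * Real.sin b * Real.sin c) *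
      Complex.exp (a * Complex.I) * (Real.sin a *
        -Complex.exp ((-(Real.pi / 3 + b) : ℝ) * Complex.I)) := by
    rw [← sin_mul_exp_sub_sin habc]
    linear_combination hQk - hRk
  have hn := congrArg norm hQR
  simp only [norm_mul, norm_neg, Complex.norm_exp_ofReal_mul_I, Complex.norm_real,
    Real.norm_of_nonneg hsa.le, Real.norm_of_nonneg hsb.le, Real.norm_of_nonneg hsc.le,
    Real.norm_of_nonneg hs3.le, Complex.norm_ofNat] at hn
  rw [dist_eq_norm, dist_comm A B, dist_eq_norm, hn]
  ring

lemma dist_trisector_inter_eq_of_signedArea_pos {A B C P Q R : ℂ} (h : 0 < signedArea A B C)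
    (hP : ∠ P B C = ∠ A B C / 3 ∧ ∠ P C B = ∠ A C B / 3 ∧
      (affineSpan ℝ ({B, C} : Set ℂ)).SSameSide P A)
    (hQ : ∠ Q C A = ∠ B C A / 3 ∧ ∠ Q A C = ∠ B A C / 3 ∧
      (affineSpan ℝ ({C, A} : Set ℂ)).SSameSide Q B)
    (hR : ∠ R A B = ∠ C A B / 3 ∧ ∠ R B A = ∠ C B A / 3 ∧
      (affineSpan ℝ ({A, B} : Set ℂ)).SSameSide R C) :
    dist P Q = dist Q R ∧ dist Q R = dist R P := by
  obtain ⟨hPB, hPC, hPs⟩ := hP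
  obtain ⟨hQC, hQA, hQs⟩ := hQ
  obtain ⟨hRA, hRB, hRs⟩ := hR
  have h₁ : 0 < signedArea B C A := by rwa [signedArea_rotate]
  have h₂ : 0 < signedArea C A B := by rwa [signedArea_rotate]
  have hP' := signedArea_pos_of_sSameSide hPs h₁
  have hQ' := signedArea_pos_of_sSameSide hQs h₂
  have hR' := signedArea_pos_of_sSameSide hRs h
  obtain ⟨a, ha⟩ : ∃ a, ∠ C A B = 3 * a := ⟨∠ C A B / 3, by ring⟩
  obtain ⟨b, hb⟩ : ∃ b, ∠ A B C = 3 * b := ⟨∠ A B C / 3, by ring⟩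
  obtain ⟨c, hc⟩ : ∃ c, ∠ B C A = 3 * c := ⟨∠ B C A / 3, by ring⟩
  have hA0 := (sub_mul_sin_add_angle h).1
  have hB0 := (sub_mul_sin_add_angle h₁).1
  have hC0 := (sub_mul_sin_add_angle h₂).1
  have hsum := EuclideanGeometry.angle_add_angle_add_angle_eq_pi (p₁ := A) (p₂ := B) C
    (by rintro rfl; simp [signedArea] at h)
  have hsum' : a + b + c = Real.pi / 3 := by linarith
  have ha' := angle_comm B A C ▸ ha
  have hb' := angle_comm A B C ▸ hb
  have hc' := angle_comm B C A ▸ hc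
  rw [ha] at hA0 hRA
  rw [hb] at hB0 hPB
  rw [hc] at hC0 hQC
  rw [ha'] at hQA
  rw [hb'] at hRB
  rw [hc'] at hPC
  rw [mul_div_cancel_left₀ _ (three_ne_zero' ℝ)] at hRA hPB hQC hQA hRB hPC
  have a0 : 0 < a := by linarith
  have b0 : 0 < b := by linarith
  have c0 : 0 < c := by linarith
  have dA := dist_trisector_inter h a0 b0 c0 hsum' ha hb' hQ' hQC hQA hR' hRA hRB
  have dB := dist_trisector_inter h₁ b0 c0 a0 (by linarith) hb hc' hR' hRA hRB hP' hPB hPC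
  have dC := dist_trisector_inter h₂ c0 a0 b0 (by linarith) hc ha' hP' hPB hPC hQ' hQC hQA
  have l₁ := EuclideanGeometry.law_sin B C A
  have l₂ := EuclideanGeometry.law_sin C A B
  have sa : Real.sin (3 * a) ≠ 0 :=
    (Real.sin_pos_of_pos_of_lt_pi (by linarith) (by linarith)).ne'
  have sb : Real.sin (3 * b) ≠ 0 :=
    (Real.sin_pos_of_pos_of_lt_pi (by linarith) (by linarith)).ne'
  have sc : Real.sin (3 * c) ≠ 0 :=
    (Real.sin_pos_of_pos_of_lt_pi (by linarith) (by linarith)).ne'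
  rw [hc, hb] at l₁
  rw [ha, hc] at l₂
  constructor
  · apply mul_right_cancel₀ (mul_ne_zero sb sc)
    linear_combination Real.sin (3 * c) * dC - Real.sin (3 * b) * dA +
      4 * Real.sin a * Real.sin b * Real.sin c * l₁
  · apply mul_right_cancel₀ (mul_ne_zero sa sc)
    linear_combination Real.sin (3 * a) * dA - Real.sin (3 * c) * dB +
      4 * Real.sin a * Real.sin b * Real.sin c * l₂

/-- **Morley's Theorem.** In a non-degenerate triangle `ABC`, for each side the two
adjacent interior-angle trisectors (the trisector from each endpoint of the side that is
closest to that side) meet in a point; the three points `P, Q, R` so obtained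
(from sides `BC`, `CA`, `AB` respectively) form an equilateral triangle.
The point `P` is characterized by lying strictly on the same side of line `BC` as `A`
and satisfying `∠PBC = ∠ABC/3` and `∠PCB = ∠ACB/3`; similarly for `Q` and `R`. -/
theorem morley (A B C P Q R : ℂ)
    (hABC : ¬ Collinear ℝ ({A, B, C} : Set ℂ))
    -- `P` is the intersection of the trisectors adjacent to side `BC`:
    (hP : ∠ P B C = ∠ A B C / 3 ∧ ∠ P C B = ∠ A C B / 3 ∧
      (affineSpan ℝ ({B, C} : Set ℂ)).SSameSide P A)
    -- `Q` is the intersection of the trisectors adjacent to side `CA`: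
    (hQ : ∠ Q C A = ∠ B C A / 3 ∧ ∠ Q A C = ∠ B A C / 3 ∧
      (affineSpan ℝ ({C, A} : Set ℂ)).SSameSide Q B)
    -- `R` is the intersection of the trisectors adjacent to side `AB`:
    (hR : ∠ R A B = ∠ C A B / 3 ∧ ∠ R B A = ∠ C B A / 3 ∧
      (affineSpan ℝ ({A, B} : Set ℂ)).SSameSide R C) :
    dist P Q = dist Q R ∧ dist Q R = dist R P := by
  rcases (signedArea_ne_zero hABC).lt_or_gt with h | h
  · have h' : 0 < signedArea A C B := by rw [signedArea_swap]; linarith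
    obtain ⟨hPB, hPC, hPs⟩ := hP
    obtain ⟨hQC, hQA, hQs⟩ := hQ
    obtain ⟨hRA, hRB, hRs⟩ := hR
    rw [Set.pair_comm] at hPs hQs hRs
    obtain ⟨h₁, h₂⟩ := dist_trisector_inter_eq_of_signedArea_pos h' ⟨hPC, hPB, hPs⟩
      ⟨hRB, hRA, hRs⟩ ⟨hQA, hQC, hQs⟩
    rw [dist_comm P R, dist_comm R Q] at h₁
    rw [dist_comm R Q, dist_comm Q P] at h₂
    exact ⟨h₂.symm, h₁.symm⟩
  · exact dist_trisector_inter_eq_of_signedArea_pos h hP hQ hR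
end

section
/- (Ptolemy's Theorem) Let P₁, P₂, P₃, P₄ be four distinct points lying in this cyclic order on a circle in the Euclidean plane. Then dist(P₁,P₃) · dist(P₂,P₄) = dist(P₁,P₂) · dist(P₃,P₄) + dist(P₂,P₃) · dist(P₄,P₁). -/
/-- A chord of a circle of radius `R` subtending a central angle `b - a ∈ [0, 2π]` has length
`2 R sin (b / 2 - a / 2)`. -/
theorem dist_add_mul_exp_mul_I (O : ℂ) {R a b : ℝ} (hR : 0 ≤ R) (hab : a ≤ b)
    (hba : b - a ≤ 2 * Real.pi) :
    dist (O + R * Complex.exp (a * Complex.I)) (O + R * Complex.exp (b * Complex.I)) =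
      2 * R * Real.sin (b / 2 - a / 2) := by
  have hfactor : (R : ℂ) * Complex.exp (b * Complex.I) - R * Complex.exp (a * Complex.I) =
      R * (Complex.exp (a * Complex.I) *
        (Complex.exp (Complex.I * (b - a : ℝ)) - 1)) := by
    rw [mul_sub, ← Complex.exp_add, mul_sub, mul_one]
    push_cast
    ring_nf
  have hsin : 0 ≤ Real.sin ((b - a) / 2) :=
    Real.sin_nonneg_of_nonneg_of_le_pi (by linarith) (by linarith)
  rw [dist_add_left, dist_comm, dist_eq_norm, hfactor, norm_mul, norm_mul,
    Complex.norm_exp_ofReal_mul_I, Complex.norm_exp_I_mul_ofReal_sub_one, Complex.norm_real,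
    Real.norm_of_nonneg hR, Real.norm_of_nonneg (by positivity), sub_div]
  ring

/-- Ptolemy's identity for sines of differences. -/
theorem sin_sub_mul_sin_sub (a b c d : ℝ) :
    Real.sin (c - a) * Real.sin (d - b) =
      Real.sin (b - a) * Real.sin (d - c) + Real.sin (c - b) * Real.sin (d - a) := by
  simp only [Real.sin_sub]
  ring

/-- **Ptolemy's Theorem.** If `P₁, P₂, P₃, P₄` lie in this cyclic order on a circle
(with center `O`, radius `R > 0`, parametrized by strictly increasing angles spanning
less than a full turn), then
`dist(P₁,P₃) ⬝ dist(P₂,P₄) = dist(P₁,P₂) ⬝ dist(P₃,P₄) + dist(P₂,P₃) ⬝ dist(P₄,P₁)`. -/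
theorem ptolemy (O : ℂ) (R : ℝ) (hR : 0 < R) (θ₁ θ₂ θ₃ θ₄ : ℝ)
    (hord : θ₁ < θ₂ ∧ θ₂ < θ₃ ∧ θ₃ < θ₄) (hspan : θ₄ - θ₁ < 2 * Real.pi)
    (P₁ P₂ P₃ P₄ : ℂ)
    (hP₁ : P₁ = O + R * Complex.exp (θ₁ * Complex.I))
    (hP₂ : P₂ = O + R * Complex.exp (θ₂ * Complex.I))
    (hP₃ : P₃ = O + R * Complex.exp (θ₃ * Complex.I))
    (hP₄ : P₄ = O + R * Complex.exp (θ₄ * Complex.I)) :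
    dist P₁ P₃ * dist P₂ P₄ = dist P₁ P₂ * dist P₃ P₄ + dist P₂ P₃ * dist P₄ P₁ := by
  obtain ⟨h₁₂, h₂₃, h₃₄⟩ := hord
  subst hP₁ hP₂ hP₃ hP₄
  rw [dist_comm (O + R * Complex.exp (θ₄ * Complex.I))]
  repeat rw [dist_add_mul_exp_mul_I O hR.le (by linarith) (by linarith)]
  linear_combination 4 * R ^ 2 * sin_sub_mul_sin_sub (θ₁ / 2) (θ₂ / 2) (θ₃ / 2) (θ₄ / 2)
end

section
/- (Simson Line Theorem) Let P₁, P₂, P₃ be three points forming a non-degenerate triangle, and let P₄ be any point on the circumcircle of triangle P₁P₂P₃. Then the feet of the perpendiculars from P₄ to the three lines P₁P₂, P₂P₃, and P₃P₁ are collinear. -/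
open scoped RealInnerProductSpace

theorem Complex.re_sub_sq_add_im_sub_sq_ne_zero {a b : ℂ} (h : a ≠ b) :
    (a.re - b.re) ^ 2 + (a.im - b.im) ^ 2 ≠ 0 := by
  intro h0
  apply h
  apply Complex.ext <;> nlinarith [sq_nonneg (a.re - b.re), sq_nonneg (a.im - b.im)]

/-- Three points of the complex plane are collinear iff the parallelogram they span has
area zero. -/
theorem Complex.collinear_triple_iff (a b c : ℂ) :
    Collinear ℝ ({a, b, c} : Set ℂ) ↔
      (b.re - a.re) * (c.im - a.im) - (b.im - a.im) * (c.re - a.re) = 0 := by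
  constructor
  · intro h
    obtain ⟨v, hv⟩ := (collinear_iff_of_mem (p₀ := a) (by simp)).1 h
    obtain ⟨s, rfl⟩ := hv b (by simp)
    obtain ⟨t, rfl⟩ := hv c (by simp)
    simp
    ring
  · intro h
    by_cases hab : b = a
    · subst hab
      simpa using collinear_pair ℝ b c
    have hn : (b.re - a.re) ^ 2 + (b.im - a.im) ^ 2 ≠ 0 :=
      Complex.re_sub_sq_add_im_sub_sq_ne_zero hab
    refine (collinear_iff_of_mem (p₀ := a) (by simp)).2 ⟨b - a, ?_⟩
    intro p hp
    simp only [Set.mem_insert_iff, Set.mem_singleton_iff] at hp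
    rcases hp with rfl | rfl | rfl
    · exact ⟨0, by simp⟩
    · exact ⟨1, by simp⟩
    · refine ⟨((b.re - a.re) * (p.re - a.re) + (b.im - a.im) * (p.im - a.im)) /
        ((b.re - a.re) ^ 2 + (b.im - a.im) ^ 2), ?_⟩
      apply Complex.ext
      · simp only [vadd_eq_add, Complex.add_re, Complex.smul_re, Complex.sub_re,
          smul_eq_mul]
        field_simp
        linear_combination (-(b.im - a.im)) * h
      · simp only [vadd_eq_add, Complex.add_im, Complex.smul_im, Complex.sub_im,
          smul_eq_mul]
        field_simp
        linear_combination (b.re - a.re) * h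

/-- The foot `(u, v)` of the perpendicular from the origin to the line through `(a, b)` and
`(c, d)`, in coordinates. -/
theorem foot_from_origin_coords {a b c d u v : ℝ}
    (hcol : (c - a) * (v - b) - (d - b) * (u - a) = 0)
    (hperp : u * (c - a) + v * (d - b) = 0) :
    ((c - a) ^ 2 + (d - b) ^ 2) * u = (a * d - b * c) * (d - b) ∧
      ((c - a) ^ 2 + (d - b) ^ 2) * v = -(a * d - b * c) * (c - a) := by
  constructor
  · linear_combination (c - a) * hperp - (d - b) * hcol
  · linear_combination (d - b) * hperp + (c - a) * hcol

/-- The Simson line theorem in coordinates centred at the fourth point, where `(p, q)` is the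
circumcenter, `(xᵢ, yᵢ)` are the vertices and `(uᵢ, vᵢ)` are the feet. -/
theorem simson_line_coords {x₁ y₁ x₂ y₂ x₃ y₃ p q u₁ v₁ u₂ v₂ u₃ v₃ : ℝ}
    (h₁₂ : (x₂ - x₁) ^ 2 + (y₂ - y₁) ^ 2 ≠ 0) (h₂₃ : (x₃ - x₂) ^ 2 + (y₃ - y₂) ^ 2 ≠ 0)
    (h₃₁ : (x₁ - x₃) ^ 2 + (y₁ - y₃) ^ 2 ≠ 0)
    (hc₁ : x₁ ^ 2 + y₁ ^ 2 = 2 * (p * x₁ + q * y₁))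
    (hc₂ : x₂ ^ 2 + y₂ ^ 2 = 2 * (p * x₂ + q * y₂))
    (hc₃ : x₃ ^ 2 + y₃ ^ 2 = 2 * (p * x₃ + q * y₃))
    (hcol₁ : (x₂ - x₁) * (v₁ - y₁) - (y₂ - y₁) * (u₁ - x₁) = 0)
    (hperp₁ : u₁ * (x₂ - x₁) + v₁ * (y₂ - y₁) = 0)
    (hcol₂ : (x₃ - x₂) * (v₂ - y₂) - (y₃ - y₂) * (u₂ - x₂) = 0)
    (hperp₂ : u₂ * (x₃ - x₂) + v₂ * (y₃ - y₂) = 0)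
    (hcol₃ : (x₁ - x₃) * (v₃ - y₃) - (y₁ - y₃) * (u₃ - x₃) = 0)
    (hperp₃ : u₃ * (x₁ - x₃) + v₃ * (y₁ - y₃) = 0) :
    (u₂ - u₁) * (v₃ - v₁) - (v₂ - v₁) * (u₃ - u₁) = 0 := by
  obtain ⟨hu₁, hv₁⟩ := foot_from_origin_coords hcol₁ hperp₁
  obtain ⟨hu₂, hv₂⟩ := foot_from_origin_coords hcol₂ hperp₂
  obtain ⟨hu₃, hv₃⟩ := foot_from_origin_coords hcol₃ hperp₃
  have hK : (x₁ ^ 2 + y₁ ^ 2) * (x₂ * y₃ - y₂ * x₃) + (x₂ ^ 2 + y₂ ^ 2) * (x₃ * y₁ - y₃ * x₁) +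
      (x₃ ^ 2 + y₃ ^ 2) * (x₁ * y₂ - y₁ * x₂) = 0 := by
    rw [hc₁, hc₂, hc₃]
    ring
  have hsum : (x₁ * y₂ - y₁ * x₂) * (x₂ * y₃ - y₂ * x₃) * ((x₁ - x₃) ^ 2 + (y₁ - y₃) ^ 2) +
      (x₂ * y₃ - y₂ * x₃) * (x₃ * y₁ - y₃ * x₁) * ((x₂ - x₁) ^ 2 + (y₂ - y₁) ^ 2) +
      (x₃ * y₁ - y₃ * x₁) * (x₁ * y₂ - y₁ * x₂) * ((x₃ - x₂) ^ 2 + (y₃ - y₂) ^ 2) = 0 := by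
    linear_combination
      (x₁ * y₂ - y₁ * x₂ + (x₂ * y₃ - y₂ * x₃) + (x₃ * y₁ - y₃ * x₁)) * hK
  rw [mul_comm, ← eq_div_iff h₁₂] at hu₁ hv₁
  rw [mul_comm, ← eq_div_iff h₂₃] at hu₂ hv₂
  rw [mul_comm, ← eq_div_iff h₃₁] at hu₃ hv₃
  rw [hu₁, hv₁, hu₂, hv₂, hu₃, hv₃]
  field_simp
  linear_combination
    (x₁ * y₂ - y₁ * x₂ + (x₂ * y₃ - y₂ * x₃) + (x₃ * y₁ - y₃ * x₁)) *
      ((x₂ - x₁) ^ 2 + (y₂ - y₁) ^ 2) * hsum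

/-- **Simson Line Theorem.** Let `P₁ P₂ P₃` be a non-degenerate triangle with
circumcenter `O`, and let `P₄` be a point on its circumcircle. Then the feet
`F₁, F₂, F₃` of the perpendiculars from `P₄` to the lines `P₁P₂`, `P₂P₃`, `P₃P₁`
are collinear. -/
theorem simson_line (P₁ P₂ P₃ P₄ O F₁ F₂ F₃ : ℂ)
    (htri : ¬ Collinear ℝ ({P₁, P₂, P₃} : Set ℂ))
    -- `O` is the circumcenter of the triangle `P₁ P₂ P₃`:
    (hO : dist O P₁ = dist O P₂ ∧ dist O P₂ = dist O P₃)
    -- `P₄` lies on the circumcircle: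
    (hP₄ : dist O P₄ = dist O P₁)
    -- `F₁` is the foot of the perpendicular from `P₄` to line `P₁P₂`:
    (hF₁ : Collinear ℝ ({P₁, P₂, F₁} : Set ℂ) ∧ ⟪P₄ - F₁, P₁ - P₂⟫ = 0)
    -- `F₂` is the foot of the perpendicular from `P₄` to line `P₂P₃`:
    (hF₂ : Collinear ℝ ({P₂, P₃, F₂} : Set ℂ) ∧ ⟪P₄ - F₂, P₂ - P₃⟫ = 0)
    -- `F₃` is the foot of the perpendicular from `P₄` to line `P₃P₁`:
    (hF₃ : Collinear ℝ ({P₃, P₁, F₃} : Set ℂ) ∧ ⟪P₄ - F₃, P₃ - P₁⟫ = 0) :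
    Collinear ℝ ({F₁, F₂, F₃} : Set ℂ) := by
  have h₁₂ : P₂ ≠ P₁ := by
    rintro rfl
    exact htri (by simpa using collinear_pair ℝ P₂ P₃)
  have h₂₃ : P₃ ≠ P₂ := by
    rintro rfl
    exact htri (by simpa using collinear_pair ℝ P₁ P₃)
  have h₃₁ : P₁ ≠ P₃ := by
    rintro rfl
    exact htri (by simpa [Set.pair_comm] using collinear_pair ℝ P₁ P₂)
  have hcirc : ∀ P : ℂ, dist O P₄ = dist O P →
      (P.re - P₄.re) ^ 2 + (P.im - P₄.im) ^ 2 =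
        2 * ((O.re - P₄.re) * (P.re - P₄.re) + (O.im - P₄.im) * (P.im - P₄.im)) := by
    intro P h
    rw [Complex.dist_eq_re_im, Complex.dist_eq_re_im,
      Real.sqrt_inj (by positivity) (by positivity)] at h
    linear_combination -h
  have hperp : ∀ F A B : ℂ, ⟪P₄ - F, A - B⟫ = 0 →
      (F.re - P₄.re) * ((B.re - P₄.re) - (A.re - P₄.re)) +
        (F.im - P₄.im) * ((B.im - P₄.im) - (A.im - P₄.im)) = 0 := by
    intro F A B h
    simp [Complex.inner] at h
    linear_combination h
  have hne : ∀ A B : ℂ, B ≠ A → ((B.re - P₄.re) - (A.re - P₄.re)) ^ 2 +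
      ((B.im - P₄.im) - (A.im - P₄.im)) ^ 2 ≠ 0 := by
    intro A B h
    simpa using Complex.re_sub_sq_add_im_sub_sq_ne_zero h
  obtain ⟨hc₁, hp₁⟩ := hF₁
  obtain ⟨hc₂, hp₂⟩ := hF₂
  obtain ⟨hc₃, hp₃⟩ := hF₃
  rw [Complex.collinear_triple_iff] at hc₁ hc₂ hc₃ ⊢
  have key := simson_line_coords (hne _ _ h₁₂) (hne _ _ h₂₃) (hne _ _ h₃₁)
    (hcirc _ hP₄) (hcirc _ (hP₄.trans hO.1)) (hcirc _ (hP₄.trans (hO.1.trans hO.2)))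
    (by simpa using hc₁) (hperp _ _ _ hp₁) (by simpa using hc₂) (hperp _ _ _ hp₂)
    (by simpa using hc₃) (hperp _ _ _ hp₃)
  simpa using key
end

section
/- (Butterfly Theorem) Let a circle with center O be given, and let P₁, P₂, P₃, P₄ be four distinct points on the circle such that chords P₁P₃ and P₂P₄ intersect at a point M. Let ℓ be the line through M perpendicular to the line OM (assume M ≠ O). Let X be the intersection of ℓ with line P₁P₄ and Y the intersection of ℓ with line P₂P₃. Then dist(M,X) = dist(M,Y). -/
open scoped RealInnerProductSpace

section Circle

variable {E : Type*} [NormedAddCommGroup E] [InnerProductSpace ℝ E]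

/-- A third point collinear with two distinct points is given by a parameter on their line. -/
lemma Collinear.exists_eq_add_smul_sub {A B C : E} (h : Collinear ℝ ({A, B, C} : Set E))
    (hAB : A ≠ B) : ∃ t : ℝ, C = A + t • (B - A) := by
  have hC := h.mem_affineSpan_of_mem_of_ne (p₁ := A) (p₂ := B) (p₃ := C)
    (by simp) (by simp) (by simp) hAB
  obtain ⟨t, rfl⟩ := mem_affineSpan_pair_iff_exists_lineMap_eq.1 hC
  exact ⟨t, by rw [AffineMap.lineMap_apply, vsub_eq_sub, vadd_eq_add, add_comm]⟩

lemma dist_add_eq_iff_inner {O M u : E} {R : ℝ} (hR : 0 ≤ R) :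
    dist (M + u) O = R ↔ ⟪u, u⟫ - 2 * ⟪u, O - M⟫ + ⟪O - M, O - M⟫ = R ^ 2 := by
  rw [← sq_eq_sq₀ dist_nonneg hR, dist_eq_norm, show M + u - O = u - (O - M) by abel,
    norm_sub_sq_real, real_inner_self_eq_norm_sq, real_inner_self_eq_norm_sq]

/-- Two distinct points of a circle on a line through `M`: half the sum of their signed distances
from `M` is the projection of the center, and their product is the power of `M`. -/
lemma chord_relations {O M u : E} {R t : ℝ} (hR : 0 ≤ R) (h₁ : dist (M + u) O = R)
    (h₂ : dist (M + t • u) O = R) (ht : t ≠ 1) :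
    2 * ⟪u, O - M⟫ = (1 + t) * ⟪u, u⟫ ∧ t * ⟪u, u⟫ = ⟪O - M, O - M⟫ - R ^ 2 := by
  rw [dist_add_eq_iff_inner hR] at h₁ h₂
  simp only [inner_smul_left, inner_smul_right, RCLike.conj_to_real] at h₂
  have h : 2 * ⟪u, O - M⟫ = (1 + t) * ⟪u, u⟫ :=
    mul_left_cancel₀ (sub_ne_zero.2 ht) (by linear_combination h₁ - h₂)
  exact ⟨h, by linear_combination -h₁ - h⟩

/-- Three pairwise distinct points of a circle are not collinear. -/
lemma not_collinear_of_dist_eq {O A B C : E} {R : ℝ} (hA : dist A O = R) (hB : dist B O = R)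
    (hC : dist C O = R) (hAB : A ≠ B) (hAC : A ≠ C) (hBC : B ≠ C) :
    ¬ Collinear ℝ ({A, B, C} : Set E) := by
  intro h
  obtain ⟨t, rfl⟩ := h.exists_eq_add_smul_sub hAB
  have ht : t ≠ 1 := by
    rintro rfl
    simp at hBC
  have hR : 0 ≤ R := hA ▸ dist_nonneg
  have h₀ := (dist_add_eq_iff_inner (O := O) (M := A) (u := 0) hR).1 (by simpa using hA)
  have hk := (chord_relations hR (by simpa using hB) hC ht).2
  simp only [inner_zero_left, mul_zero, sub_zero, zero_add] at h₀
  rw [h₀, sub_self, mul_eq_zero, inner_self_eq_zero, sub_eq_zero] at hk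
  rcases hk with rfl | hk
  · simp at hAC
  · exact hAB hk.symm

/-- A line meeting the hyperplane through `M` orthogonal to `n` in a single point is not parallel
to it. -/
lemma inner_sub_ne_zero_of_unique {M n A B X : E} (hAB : A ≠ B)
    (hX : Collinear ℝ ({A, B, X} : Set E) ∧ ⟪X - M, n⟫ = 0)
    (hXu : ∀ W : E, Collinear ℝ ({A, B, W} : Set E) → ⟪W - M, n⟫ = 0 → W = X) :
    ⟪B - A, n⟫ ≠ 0 := by
  intro h
  obtain ⟨t, rfl⟩ := hX.1.exists_eq_add_smul_sub hAB
  have hA : ⟪A - M, n⟫ = 0 := by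
    have := hX.2
    rwa [add_sub_right_comm, inner_add_left, inner_smul_left, h, mul_zero, add_zero] at this
  have hB : ⟪B - M, n⟫ = 0 := by
    rw [← sub_add_sub_cancel B A M, inner_add_left, h, hA, add_zero]
  have hcA : Collinear ℝ ({A, B, A} : Set E) :=
    (collinear_pair ℝ A B).subset (by simp [Set.insert_subset_iff])
  have hcB : Collinear ℝ ({A, B, B} : Set E) :=
    (collinear_pair ℝ A B).subset (by simp)
  exact hAB ((hXu A hcA hA).trans (hXu B hcB hB).symm)

end Circle

/-- **Butterfly Theorem.** Let `P₁, P₂, P₃, P₄` be four distinct points on a circle with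
center `O` such that the chords `P₁P₃` and `P₂P₄` meet at a point `M ≠ O`. Let `ℓ` be
the line through `M` perpendicular to `OM`, and let `X = ℓ ∩ line P₁P₄` and
`Y = ℓ ∩ line P₂P₃` (each assumed to be a unique intersection point). Then
`dist M X = dist M Y`. -/
theorem butterfly (O : ℂ) (R : ℝ) (hR : 0 < R) (P₁ P₂ P₃ P₄ M X Y : ℂ)
    (hon : dist P₁ O = R ∧ dist P₂ O = R ∧ dist P₃ O = R ∧ dist P₄ O = R)
    (hdist : [P₁, P₂, P₃, P₄].Pairwise (· ≠ ·))
    -- `M` is on both chords `P₁P₃` and `P₂P₄`: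
    (hM : Collinear ℝ ({P₁, P₃, M} : Set ℂ) ∧ Collinear ℝ ({P₂, P₄, M} : Set ℂ))
    (hMO : M ≠ O)
    -- `X` is the unique common point of `ℓ` (through `M`, perpendicular to `OM`) and line `P₁P₄`:
    (hX : Collinear ℝ ({P₁, P₄, X} : Set ℂ) ∧ ⟪X - M, O - M⟫ = 0)
    (hXu : ∀ W : ℂ, Collinear ℝ ({P₁, P₄, W} : Set ℂ) → ⟪W - M, O - M⟫ = 0 → W = X)
    -- `Y` is the unique common point of `ℓ` and line `P₂P₃`:
    (hY : Collinear ℝ ({P₂, P₃, Y} : Set ℂ) ∧ ⟪Y - M, O - M⟫ = 0)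
    (hYu : ∀ W : ℂ, Collinear ℝ ({P₂, P₃, W} : Set ℂ) → ⟪W - M, O - M⟫ = 0 → W = Y) :
    dist M X = dist M Y := by
  obtain ⟨h1, h2, h3, h4⟩ := hon
  simp only [List.pairwise_cons, List.mem_cons, List.not_mem_nil, or_false, forall_eq_or_imp,
    forall_eq, IsEmpty.forall_iff, implies_true, List.Pairwise.nil, and_true] at hdist
  obtain ⟨⟨h12, h13, h14⟩, ⟨h23, h24⟩, h34⟩ := hdist
  have hdX := inner_sub_ne_zero_of_unique h14 hX hXu
  have hdY := inner_sub_ne_zero_of_unique h23 hY hYu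
  have hM1 : M ≠ P₁ := by
    rintro rfl
    exact not_collinear_of_dist_eq h2 h4 h1 h24 h12.symm h14.symm hM.2
  have hM2 : M ≠ P₂ := by
    rintro rfl
    exact not_collinear_of_dist_eq h1 h3 h2 h13 h12 h23.symm hM.1
  obtain ⟨c, rfl⟩ := Collinear.exists_eq_add_smul_sub (A := M) (B := P₁) (C := P₃)
    (hM.1.subset (by simp [Set.insert_subset_iff])) hM1
  obtain ⟨d, rfl⟩ := Collinear.exists_eq_add_smul_sub (A := M) (B := P₂) (C := P₄)
    (hM.2.subset (by simp [Set.insert_subset_iff])) hM2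
  obtain ⟨t, rfl⟩ := hX.1.exists_eq_add_smul_sub h14
  obtain ⟨s, rfl⟩ := hY.1.exists_eq_add_smul_sub h23
  clear hXu hYu hM
  obtain ⟨u, rfl⟩ : ∃ u, P₁ = M + u := ⟨P₁ - M, by abel⟩
  obtain ⟨v, rfl⟩ : ∃ v, P₂ = M + v := ⟨P₂ - M, by abel⟩
  simp only [add_sub_cancel_left] at *
  have hc : c ≠ 1 := by
    rintro rfl
    simp at h13
  have hd : d ≠ 1 := by
    rintro rfl
    simp at h24
  obtain ⟨hp, hk⟩ := chord_relations hR.le h1 h3 hc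
  obtain ⟨hq, hl⟩ := chord_relations hR.le h2 h4 hd
  have hXn := hX.2
  have hYn := hY.2
  rw [add_sub_add_left_eq_sub] at hdX hdY
  rw [add_sub_add_left_eq_sub, add_assoc, add_sub_cancel_left] at hXn hYn
  simp only [inner_add_left, inner_sub_left, inner_smul_left, RCLike.conj_to_real]
    at hXn hYn hdX hdY
  have hpq : c * ⟪u, O - M⟫ * (1 + d) = d * ⟪v, O - M⟫ * (1 + c) := by
    linear_combination c * (1 + d) / 2 * hp - d * (1 + c) / 2 * hq
      + (1 + c) * (1 + d) / 2 * (hk - hl)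
  generalize ⟪u, O - M⟫ = p at *
  generalize ⟪v, O - M⟫ = q at *
  have hu : 1 - t + s * c = 0 := by
    apply mul_left_cancel₀ (mul_ne_zero hdX hdY)
    linear_combination (-(c * p - q)) * hXn + c * (d * q - p) * hYn + q * hpq
  have hv : 1 - s + t * d = 0 := by
    apply mul_left_cancel₀ (mul_ne_zero hdX hdY)
    linear_combination d * (c * p - q) * hXn - (d * q - p) * hYn - p * hpq
  have hsum : (u + t • (d • v - u)) + (v + s • (c • u - v)) = 0 := by
    linear_combination (norm := module) hu • u + hv • v
  rw [add_sub_add_left_eq_sub, add_sub_add_left_eq_sub, add_assoc, add_assoc,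
    eq_neg_of_add_eq_zero_left hsum, dist_self_add_right, dist_self_add_right, norm_neg]
end

section
/- (Euler Line) Let A, B, C be three affinely independent points in the Euclidean plane. Then the orthocenter H, the circumcenter O, and the centroid G of triangle ABC are collinear. -/
open scoped RealInnerProductSpace

/-- A vector orthogonal to two sides of a nondegenerate triangle in the plane vanishes. -/
theorem eq_zero_of_inner_sides_eq_zero {A B C w : ℂ} (h : AffineIndependent ℝ ![A, B, C])
    (hB : ⟪w, B - A⟫ = 0) (hC : ⟪w, C - A⟫ = 0) : w = 0 := by
  have htop : vectorSpan ℝ (Set.range ![A, B, C]) = ⊤ :=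
    h.vectorSpan_eq_top_of_card_eq_finrank_add_one (by simp)
  have hle : vectorSpan ℝ (Set.range ![A, B, C]) ≤ (innerₛₗ ℝ w).ker := by
    rw [vectorSpan_range_eq_span_range_vsub_right ℝ _ (0 : Fin 3), Submodule.span_le]
    rintro _ ⟨i, rfl⟩
    fin_cases i
    · simp
    · simpa using hB
    · simpa using hC
  have hw : w ∈ (innerₛₗ ℝ w).ker := hle (htop ▸ Submodule.mem_top)
  exact inner_self_eq_zero.mp (LinearMap.mem_ker.mp hw)

/-- **Euler Line.** For a triangle with affinely independent vertices `A, B, C`,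
the orthocenter `H` (the common point of the altitudes), the circumcenter `O`
(the point equidistant from the vertices), and the centroid `(A + B + C)/3`
are collinear. -/
theorem euler_line (A B C H O : ℂ) (h : AffineIndependent ℝ ![A, B, C])
    -- `H` is the orthocenter (lies on all three altitudes):
    (hH : ⟪H - A, C - B⟫ = 0 ∧ ⟪H - B, C - A⟫ = 0 ∧ ⟪H - C, B - A⟫ = 0)
    -- `O` is the circumcenter:
    (hO : dist O A = dist O B ∧ dist O B = dist O C) :
    Collinear ℝ ({H, O, (3 : ℝ)⁻¹ • (A + B + C)} : Set ℂ) := by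
  obtain ⟨-, hHB, hHC⟩ := hH
  have bisector {P Q : ℂ} (hPQ : dist O P = dist O Q) : ⟪(2 : ℝ) • O - P - Q, Q - P⟫ = 0 := by
    have := (real_inner_add_sub_eq_zero_iff (O - P) (O - Q)).mpr
      (by simpa [dist_eq_norm] using hPQ)
    convert this using 2 <;> module
  have hw : H + (2 : ℝ) • O - (A + B + C) = 0 := by
    apply eq_zero_of_inner_sides_eq_zero h
    · rw [show H + (2 : ℝ) • O - (A + B + C) = (H - C) + ((2 : ℝ) • O - A - B) by module,
        inner_add_left, hHC, bisector hO.1, add_zero]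
    · rw [show H + (2 : ℝ) • O - (A + B + C) = (H - B) + ((2 : ℝ) • O - A - C) by module,
        inner_add_left, hHB, bisector (hO.1.trans hO.2), add_zero]
  refine (collinear_iff_of_mem (p₀ := O) (by simp)).mpr ⟨H - O, ?_⟩
  rintro _ (rfl | rfl | rfl)
  · exact ⟨1, by simp⟩
  · exact ⟨0, by simp⟩
  · refine ⟨3⁻¹, ?_⟩
    rw [← sub_eq_zero.mp hw, vadd_eq_add]
    module
end

section
/- (Nine-Point Circle) Let A, B, C be three affinely independent points in the Euclidean plane with orthocenter O. Then the following nine points are concyclic: the feet of the three altitudes (the orthogonal projections of A onto line BC, of B onto line AC, and of C onto line AB), the midpoints of the three sides AB, AC, BC, and the midpoints of the three segments OA, OB, OC. -/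
open scoped RealInnerProductSpace

section EulerQuadrangle

variable {V : Type*} [NormedAddCommGroup V] [InnerProductSpace ℝ V]

/-- If `A`, `B`, `C`, `O` satisfy `OC ⊥ AB`, then their centroid is equidistant from the midpoints
of `OA` and `OB`. -/
theorem dist_centroid_midpoint_eq_of_inner_eq_zero {A B C O : V} (h : ⟪O - C, B - A⟫ = 0) :
    dist ((4⁻¹ : ℝ) • (A + B + C + O)) (midpoint ℝ O A) =
      dist ((4⁻¹ : ℝ) • (A + B + C + O)) (midpoint ℝ O B) := by
  rw [dist_eq_norm, dist_eq_norm, ← real_inner_add_sub_eq_zero_iff]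
  have hsum : (4⁻¹ : ℝ) • (A + B + C + O) - midpoint ℝ O A +
      ((4⁻¹ : ℝ) • (A + B + C + O) - midpoint ℝ O B) = (-2⁻¹ : ℝ) • (O - C) := by
    rw [midpoint_eq_smul_add, midpoint_eq_smul_add, invOf_eq_inv]
    module
  have hdiff : (4⁻¹ : ℝ) • (A + B + C + O) - midpoint ℝ O A -
      ((4⁻¹ : ℝ) • (A + B + C + O) - midpoint ℝ O B) = (2⁻¹ : ℝ) • (B - A) := by
    rw [midpoint_eq_smul_add, midpoint_eq_smul_add, invOf_eq_inv]
    module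
  rw [hsum, hdiff, real_inner_smul_left, real_inner_smul_right, h, mul_zero, mul_zero]

/-- The centroid of four points is equidistant from the midpoints of two opposite segments. -/
theorem dist_centroid_midpoint_eq_opposite (A B C O : V) :
    dist ((4⁻¹ : ℝ) • (A + B + C + O)) (midpoint ℝ B C) =
      dist ((4⁻¹ : ℝ) • (A + B + C + O)) (midpoint ℝ O A) := by
  have hneg : (4⁻¹ : ℝ) • (A + B + C + O) - midpoint ℝ B C =
      -((4⁻¹ : ℝ) • (A + B + C + O) - midpoint ℝ O A) := by
    rw [midpoint_eq_smul_add, midpoint_eq_smul_add, invOf_eq_inv]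
    module
  rw [dist_eq_norm, dist_eq_norm, hneg, norm_neg]

/-- If `O` lies on the altitude from `A`, the foot `F` of that altitude is as far from the centroid
of `A`, `B`, `C`, `O` as the midpoint of `OA`. -/
theorem dist_centroid_altitude_foot_eq {A B C O F : V} (hBC : B ≠ C)
    (hO : ⟪O - A, C - B⟫ = 0) (hcol : Collinear ℝ ({B, C, F} : Set V))
    (hF : ⟪A - F, C - B⟫ = 0) :
    dist ((4⁻¹ : ℝ) • (A + B + C + O)) F =
      dist ((4⁻¹ : ℝ) • (A + B + C + O)) (midpoint ℝ O A) := by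
  have hmem : F ∈ line[ℝ, B, C] :=
    hcol.mem_affineSpan_of_mem_of_ne (by simp) (by simp) (by simp) hBC
  obtain ⟨t, ht⟩ := mem_affineSpan_pair_iff_exists_lineMap_eq.1 hmem
  have hline : F = B + t • (C - B) := by
    rw [← ht, AffineMap.lineMap_apply_module']
    abel
  rw [dist_eq_norm, dist_eq_norm, ← real_inner_add_sub_eq_zero_iff]
  have hsum : (4⁻¹ : ℝ) • (A + B + C + O) - F +
      ((4⁻¹ : ℝ) • (A + B + C + O) - midpoint ℝ O A) = (2⁻¹ - t) • (C - B) := by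
    rw [midpoint_eq_smul_add, invOf_eq_inv, hline]
    module
  have hdiff : (4⁻¹ : ℝ) • (A + B + C + O) - F -
      ((4⁻¹ : ℝ) • (A + B + C + O) - midpoint ℝ O A) =
        (A - F) + (2⁻¹ : ℝ) • (O - A) := by
    rw [midpoint_eq_smul_add, invOf_eq_inv]
    module
  rw [hsum, hdiff, real_inner_smul_left, real_inner_comm, inner_add_left, real_inner_smul_left,
    hF, hO, mul_zero, add_zero, mul_zero]

end EulerQuadrangle

/-- **Nine-Point Circle.** Let `A, B, C` be affinely independent points with
orthocenter `O`. Then the feet `F₁, F₂, F₃` of the three altitudes, the midpoints of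
the three sides, and the midpoints of the segments `OA`, `OB`, `OC` all lie on one
circle: there is a center `N` and a radius `ρ` at distance `ρ` from all nine points. -/
theorem nine_point_circle (A B C O F₁ F₂ F₃ : ℂ)
    (h : AffineIndependent ℝ ![A, B, C])
    -- `O` is the orthocenter (lies on all three altitudes):
    (hO : ⟪O - A, C - B⟫ = 0 ∧ ⟪O - B, C - A⟫ = 0 ∧ ⟪O - C, B - A⟫ = 0)
    -- `F₁` is the foot of the altitude from `A` (orthogonal projection of `A` on line `BC`):
    (hF₁ : Collinear ℝ ({B, C, F₁} : Set ℂ) ∧ ⟪A - F₁, C - B⟫ = 0)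
    -- `F₂` is the foot of the altitude from `B`:
    (hF₂ : Collinear ℝ ({A, C, F₂} : Set ℂ) ∧ ⟪B - F₂, C - A⟫ = 0)
    -- `F₃` is the foot of the altitude from `C`:
    (hF₃ : Collinear ℝ ({A, B, F₃} : Set ℂ) ∧ ⟪C - F₃, B - A⟫ = 0) :
    ∃ (N : ℂ) (ρ : ℝ),
      dist N F₁ = ρ ∧ dist N F₂ = ρ ∧ dist N F₃ = ρ ∧
      dist N (midpoint ℝ A B) = ρ ∧ dist N (midpoint ℝ A C) = ρ ∧
      dist N (midpoint ℝ B C) = ρ ∧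
      dist N (midpoint ℝ O A) = ρ ∧ dist N (midpoint ℝ O B) = ρ ∧
      dist N (midpoint ℝ O C) = ρ := by
  obtain ⟨hOA, hOB, hOC⟩ := hO
  have hAB : A ≠ B := h.injective.ne (show (0 : Fin 3) ≠ 1 by decide)
  have hAC : A ≠ C := h.injective.ne (show (0 : Fin 3) ≠ 2 by decide)
  have hBC : B ≠ C := h.injective.ne (show (1 : Fin 3) ≠ 2 by decide)
  have hB : B + A + C + O = A + B + C + O := by ring
  have hC : C + A + B + O = A + B + C + O := by ring
  have hAC' : A + C + B + O = A + B + C + O := by ring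
  have eAB := dist_centroid_midpoint_eq_of_inner_eq_zero hOC
  have eAC := dist_centroid_midpoint_eq_of_inner_eq_zero hOB
  have mA := dist_centroid_midpoint_eq_opposite A B C O
  have mB := dist_centroid_midpoint_eq_opposite B A C O
  have mC := dist_centroid_midpoint_eq_opposite C A B O
  have fA := dist_centroid_altitude_foot_eq hBC hOA hF₁.1 hF₁.2
  have fB := dist_centroid_altitude_foot_eq hAC hOB hF₂.1 hF₂.2
  have fC := dist_centroid_altitude_foot_eq hAB hOC hF₃.1 hF₃.2
  rw [hAC'] at eAC
  rw [hB] at mB fB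
  rw [hC] at mC fC
  exact ⟨(4⁻¹ : ℝ) • (A + B + C + O), _, fA, fB.trans eAB.symm, fC.trans eAC.symm,
    mC.trans eAC.symm, mB.trans eAB.symm, mA, rfl, eAB.symm, eAC.symm⟩
end

section
/- (Feuerbach's Theorem) Let A, B, C be three affinely independent points in the Euclidean plane. Then the nine-point circle of triangle ABC (the circle through the midpoints of the three sides) is internally tangent to the incircle of triangle ABC, i.e. the two circles touch: the distance between their centers equals the absolute difference of their radii. -/
/-- Twice the signed area of the triangle `P Q X`. -/
noncomputable def twiceArea (P Q X : ℂ) : ℝ :=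
  (Q - P).re * (X - P).im - (Q - P).im * (X - P).re

lemma sq_dist_eq (x y : ℂ) : dist x y ^ 2 = (x.re - y.re) ^ 2 + (x.im - y.im) ^ 2 := by
  rw [Complex.dist_eq, Complex.sq_norm, Complex.normSq_apply]
  simp only [Complex.sub_re, Complex.sub_im]
  ring

/-- Base times height is twice the area. -/
lemma abs_twiceArea_eq (P Q X : ℂ) :
    |twiceArea P Q X| =
      Metric.infDist X (affineSpan ℝ ({P, Q} : Set ℂ) : Set ℂ) * dist P Q := by
  set s := affineSpan ℝ ({P, Q} : Set ℂ)
  have hP : P ∈ s := left_mem_affineSpan_pair ℝ P Q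
  have hQ : Q ∈ s := right_mem_affineSpan_pair ℝ P Q
  have : Nonempty s := ⟨⟨P, hP⟩⟩
  rw [← EuclideanGeometry.dist_orthogonalProjection_eq_infDist s X]
  set F : ℂ := (EuclideanGeometry.orthogonalProjection s X : ℂ)
  have hFs : F ∈ s := EuclideanGeometry.orthogonalProjection_mem X
  have horth : inner ℝ (Q - P) (X - F) = 0 :=
    Submodule.inner_right_of_mem_orthogonal (AffineSubspace.vsub_mem_direction hQ hP)
      (EuclideanGeometry.vsub_orthogonalProjection_mem_direction_orthogonal s X)
  obtain ⟨t, ht⟩ := mem_affineSpan_pair_iff_exists_lineMap_eq.1 hFs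
  have hre : F.re = P.re + t * (Q.re - P.re) := by
    rw [← ht]; simp [AffineMap.lineMap_apply]; ring
  have him : F.im = P.im + t * (Q.im - P.im) := by
    rw [← ht]; simp [AffineMap.lineMap_apply]; ring
  rw [Complex.inner] at horth
  simp only [Complex.mul_re, Complex.conj_re, Complex.conj_im, Complex.sub_re, Complex.sub_im]
    at horth
  rw [← abs_of_nonneg (mul_nonneg (dist_nonneg (x := X) (y := F)) (dist_nonneg (x := P) (y := Q))),
    ← sq_eq_sq_iff_abs_eq_abs, mul_pow, sq_dist_eq, sq_dist_eq, twiceArea]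
  simp only [Complex.sub_re, Complex.sub_im]
  have hcross : (Q.re - P.re) * (X.im - P.im) - (Q.im - P.im) * (X.re - P.re) =
      (Q.re - P.re) * (X.im - F.im) - (Q.im - P.im) * (X.re - F.re) := by
    rw [hre, him]; ring
  rw [hcross]
  linear_combination
    (-((Q.re - P.re) * (X.re - F.re) + (Q.im - P.im) * (X.im - F.im))) * horth

lemma infDist_pos_of_sSameSide {P Q X Y : ℂ}
    (h : (affineSpan ℝ ({P, Q} : Set ℂ)).SSameSide X Y) :
    0 < Metric.infDist X (affineSpan ℝ ({P, Q} : Set ℂ) : Set ℂ) :=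
  ((AffineSubspace.closed_of_finiteDimensional _).notMem_iff_infDist_pos
    ⟨P, left_mem_affineSpan_pair ℝ P Q⟩).1 h.left_notMem

lemma twiceArea_mul_pos_of_sSameSide {P Q X Y : ℂ} (hPQ : P ≠ Q)
    (h : (affineSpan ℝ ({P, Q} : Set ℂ)).SSameSide X Y) :
    0 < twiceArea P Q X * twiceArea P Q Y := by
  have hne : ∀ {X Y : ℂ}, (affineSpan ℝ ({P, Q} : Set ℂ)).SSameSide X Y →
      twiceArea P Q X ≠ 0 := fun h => by
    rw [← abs_pos, abs_twiceArea_eq]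
    exact mul_pos (infDist_pos_of_sSameSide h) (dist_pos.2 hPQ)
  have hP : P ∈ affineSpan ℝ ({P, Q} : Set ℂ) := left_mem_affineSpan_pair ℝ P Q
  have hX := hne h
  have hY := hne h.symm
  obtain ⟨-, hYs, p, hp, hray⟩ := (AffineSubspace.sSameSide_iff_exists_left hP).1 h
  obtain ⟨t, rfl⟩ := mem_affineSpan_pair_iff_exists_lineMap_eq.1 hp
  obtain ⟨k, l, hk, hl, hkl⟩ := hray.exists_pos
    (vsub_ne_zero.2 fun e => h.left_notMem (e ▸ hP))
    (vsub_ne_zero.2 fun e => hYs (e ▸ hp))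
  have hre := congrArg Complex.re hkl
  have him := congrArg Complex.im hkl
  simp [AffineMap.lineMap_apply] at hre him
  have key : k * twiceArea P Q X = l * twiceArea P Q Y := by
    simp only [twiceArea, Complex.sub_re, Complex.sub_im]
    linear_combination (Q.re - P.re) * him - (Q.im - P.im) * hre
  have h2 : 0 < l * (twiceArea P Q X * twiceArea P Q Y) := by
    have : l * (twiceArea P Q X * twiceArea P Q Y) = k * twiceArea P Q X ^ 2 := by
      linear_combination (-twiceArea P Q X) * key
    rw [this]; positivity
  exact pos_of_mul_pos_right h2 hl.le

/-- If `X` and `Y` lie on the same side of the line `P Q`, the signed area of `P Q X` has the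
orientation of `P Q Y`. -/
lemma twiceArea_eq_sign_mul {P Q X Y : ℂ} (hPQ : P ≠ Q)
    (h : (affineSpan ℝ ({P, Q} : Set ℂ)).SSameSide X Y) :
    twiceArea P Q X = SignType.sign (twiceArea P Q Y) *
      (Metric.infDist X (affineSpan ℝ ({P, Q} : Set ℂ) : Set ℂ) * dist P Q) := by
  rw [← abs_twiceArea_eq]
  have := twiceArea_mul_pos_of_sSameSide hPQ h
  rcases pos_and_pos_or_neg_and_neg_of_mul_pos this with ⟨h1, h2⟩ | ⟨h1, h2⟩
  · simp [sign_pos h2, abs_of_pos h1]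
  · simp [sign_neg h2, abs_of_neg h1]

/-- Feuerbach's theorem in coordinates with a vertex at the origin and the other two vertices at
`(u₁, u₂)` and `(v₁, v₂)`; `(x, y)` is the nine-point center and `(p, q)` the incenter. -/
lemma feuerbach_coordinates {u₁ u₂ v₁ v₂ x y p q a b c n r ε : ℝ}
    (ha : 0 < a) (hb : 0 < b) (hc : 0 < c) (hr : 0 < r) (hn : 0 ≤ n) (hε : ε ^ 2 = 1)
    (ha2 : a ^ 2 = (u₁ - v₁) ^ 2 + (u₂ - v₂) ^ 2) (hb2 : b ^ 2 = v₁ ^ 2 + v₂ ^ 2)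
    (hc2 : c ^ 2 = u₁ ^ 2 + u₂ ^ 2)
    (hu : (x - u₁ / 2) ^ 2 + (y - u₂ / 2) ^ 2 = n ^ 2)
    (huv : (x - (u₁ + v₁) / 2) ^ 2 + (y - (u₂ + v₂) / 2) ^ 2 = n ^ 2)
    (hv : (x - v₁ / 2) ^ 2 + (y - v₂ / 2) ^ 2 = n ^ 2)
    (hA : (v₁ - u₁) * (q - u₂) - (v₂ - u₂) * (p - u₁) = ε * (r * a))
    (hB : p * v₂ - q * v₁ = ε * (r * b)) (hC : u₁ * q - u₂ * p = ε * (r * c)) :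
    (x - p) ^ 2 + (y - q) ^ 2 = (n - r) ^ 2 := by
  set s := a + b + c with hs
  have hspos : 0 < s := by positivity
  have hε0 : ε ≠ 0 := by rintro rfl; norm_num at hε
  obtain ⟨g, hg⟩ : ∃ g, g = u₁ * v₁ + u₂ * v₂ := ⟨_, rfl⟩
  have hg2 : 2 * g = b ^ 2 + c ^ 2 - a ^ 2 := by rw [hg, ha2, hb2, hc2]; ring
  have hD : u₁ * v₂ - u₂ * v₁ = ε * (r * s) := by
    rw [hs]; linear_combination hA + hB + hC
  have hK : (r * s) ^ 2 = b ^ 2 * c ^ 2 - g ^ 2 := by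
    have : (r * s) ^ 2 = (u₁ * v₂ - u₂ * v₁) ^ 2 := by
      rw [hD]; linear_combination (-(r * s) ^ 2) * hε
    rw [this, hb2, hc2, hg]; ring
  have hεr : ε * r ≠ 0 := mul_ne_zero hε0 hr.ne'
  have hp : s * p = b * u₁ + c * v₁ := by
    apply mul_left_cancel₀ hεr
    linear_combination (-p) * hD + u₁ * hB + v₁ * hC
  have hq : s * q = b * u₂ + c * v₂ := by
    apply mul_left_cancel₀ hεr
    linear_combination (-q) * hD + u₂ * hB + v₂ * hC
  have hxu : x * u₁ + y * u₂ = (c ^ 2 + 2 * g) / 4 := by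
    rw [hc2, hg]; linear_combination hv - huv
  have hxv : x * v₁ + y * v₂ = (b ^ 2 + 2 * g) / 4 := by
    rw [hb2, hg]; linear_combination hu - huv
  have hpq : s ^ 2 * (p ^ 2 + q ^ 2) = 2 * b ^ 2 * c ^ 2 + 2 * b * c * g := by
    have : s ^ 2 * (p ^ 2 + q ^ 2) = (s * p) ^ 2 + (s * q) ^ 2 := by ring
    rw [this, hp, hq, hg]
    linear_combination (-b ^ 2) * hc2 - c ^ 2 * hb2
  have hxp : s * (x * p + y * q) = b * ((c ^ 2 + 2 * g) / 4) + c * ((b ^ 2 + 2 * g) / 4) := by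
    linear_combination x * hp + y * hq + b * hxu + c * hxv
  have hn2 : x ^ 2 + y ^ 2 = n ^ 2 + g / 2 := by
    linear_combination hu + hxu + hc2 / 4
  -- The nine-point radius is half the circumradius.
  have hnr : 4 * (n * r * s) = a * b * c := by
    have hgram : (x ^ 2 + y ^ 2) * (r * s) ^ 2 = ((c ^ 2 + 2 * g) / 4) ^ 2 * b ^ 2 +
        ((b ^ 2 + 2 * g) / 4) ^ 2 * c ^ 2 -
        2 * ((c ^ 2 + 2 * g) / 4) * ((b ^ 2 + 2 * g) / 4) * g := by
      rw [hK, ← hxu, ← hxv, hb2, hc2, hg]; ring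
    refine (sq_eq_sq₀ (by positivity) (by positivity)).1 ?_
    have ha3 : a ^ 2 = b ^ 2 + c ^ 2 - 2 * g := by linear_combination hg2
    rw [hn2] at hgram
    rw [mul_pow, mul_pow (a * b), mul_pow a, ha3]
    linear_combination 16 * hgram - 8 * g * hK
  have hs2 : s ^ 2 ≠ 0 := by positivity
  apply mul_left_cancel₀ hs2
  have hmain : s ^ 2 * ((x - p) ^ 2 + (y - q) ^ 2) - s ^ 2 * (n - r) ^ 2 =
      s ^ 2 * (g / 2) - 2 * s * (b * ((c ^ 2 + 2 * g) / 4) + c * ((b ^ 2 + 2 * g) / 4)) +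
      (2 * b ^ 2 * c ^ 2 + 2 * b * c * g) + s * (a * b * c) / 2 -
      (b ^ 2 * c ^ 2 - g ^ 2) := by
    linear_combination s ^ 2 * hn2 - 2 * s * hxp + hpq + s / 2 * hnr - hK
  have hg' : g = (b ^ 2 + c ^ 2 - a ^ 2) / 2 := by linarith
  rw [← sub_eq_zero, hmain, hg', hs]
  ring


/-- **Feuerbach's Theorem.** For a triangle with affinely independent vertices
`A, B, C`, the nine-point circle (the circle with center `N` and radius `n` through the
midpoints of the three sides) and the incircle (center `I` inside the triangle,
equidistant — at distance `r` — from the three side lines) are internally tangent: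
the distance between the centers equals `|n - r|`. -/
theorem feuerbach (A B C N I : ℂ) (n r : ℝ)
    (h : AffineIndependent ℝ ![A, B, C])
    -- the nine-point circle: center `N`, radius `n`, through the midpoints of the sides:
    (hN : dist N (midpoint ℝ A B) = n ∧ dist N (midpoint ℝ B C) = n ∧
          dist N (midpoint ℝ C A) = n)
    -- the incenter `I` lies strictly inside the triangle:
    (hI : (affineSpan ℝ ({B, C} : Set ℂ)).SSameSide I A ∧
          (affineSpan ℝ ({C, A} : Set ℂ)).SSameSide I B ∧
          (affineSpan ℝ ({A, B} : Set ℂ)).SSameSide I C)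
    -- and is at the same distance `r` (the inradius) from the three side lines:
    (hr : Metric.infDist I (affineSpan ℝ ({B, C} : Set ℂ) : Set ℂ) = r ∧
          Metric.infDist I (affineSpan ℝ ({C, A} : Set ℂ) : Set ℂ) = r ∧
          Metric.infDist I (affineSpan ℝ ({A, B} : Set ℂ) : Set ℂ) = r) :
    dist N I = |n - r| := by
  obtain ⟨hN₁, hN₂, hN₃⟩ := hN
  obtain ⟨hI₁, hI₂, hI₃⟩ := hI
  obtain ⟨hr₁, hr₂, hr₃⟩ := hr
  have hAB : A ≠ B := h.injective.ne (show (0 : Fin 3) ≠ 1 by decide)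
  have hBC : B ≠ C := h.injective.ne (show (1 : Fin 3) ≠ 2 by decide)
  have hCA : C ≠ A := h.injective.ne (show (2 : Fin 3) ≠ 0 by decide)
  have hrpos : 0 < r := hr₁ ▸ infDist_pos_of_sSameSide hI₁
  have hn : 0 ≤ n := hN₁ ▸ dist_nonneg
  have hA := twiceArea_eq_sign_mul hBC hI₁
  have hB := twiceArea_eq_sign_mul hCA hI₂
  have hC := twiceArea_eq_sign_mul hAB hI₃
  have hcyc₁ : twiceArea B C A = twiceArea A B C := by
    simp only [twiceArea, Complex.sub_re, Complex.sub_im]; ring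
  have hcyc₂ : twiceArea C A B = twiceArea A B C := by
    simp only [twiceArea, Complex.sub_re, Complex.sub_im]; ring
  rw [hr₁, hcyc₁] at hA
  rw [hr₂, hcyc₂] at hB
  rw [hr₃] at hC
  have hD : twiceArea A B C ≠ 0 :=
    right_ne_zero_of_mul (twiceArea_mul_pos_of_sSameSide hAB hI₃).ne'
  have hε : (SignType.sign (twiceArea A B C) : ℝ) ^ 2 = 1 := by
    rcases hD.lt_or_gt with h | h
    · simp [sign_neg h]
    · simp [sign_pos h]
  generalize (SignType.sign (twiceArea A B C) : ℝ) = ε at hA hB hC hε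
  have hmid : ∀ {X Y : ℂ}, dist N (midpoint ℝ X Y) = n →
      (N.re - (X.re + Y.re) / 2) ^ 2 + (N.im - (X.im + Y.im) / 2) ^ 2 = n ^ 2 := by
    rintro X Y rfl
    rw [sq_dist_eq, midpoint_eq_smul_add]
    simp
    ring
  have h₁ := hmid hN₁
  have h₂ := hmid hN₂
  have h₃ := hmid hN₃
  simp only [twiceArea, Complex.sub_re, Complex.sub_im] at hA hB hC
  rw [← abs_of_nonneg (dist_nonneg (x := N) (y := I)), ← sq_eq_sq_iff_abs_eq_abs, sq_dist_eq]
  have key := feuerbach_coordinates (u₁ := B.re - A.re) (u₂ := B.im - A.im)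
    (v₁ := C.re - A.re) (v₂ := C.im - A.im) (x := N.re - A.re) (y := N.im - A.im)
    (p := I.re - A.re) (q := I.im - A.im) (n := n)
    (dist_pos.2 hBC) (dist_pos.2 hCA) (dist_pos.2 hAB) hrpos hn hε
    (by rw [sq_dist_eq]; ring) (by rw [sq_dist_eq]) (by rw [sq_dist_eq]; ring)
    (by linear_combination h₁) (by linear_combination h₂) (by linear_combination h₃)
    (by linear_combination hA) (by linear_combination hB) (by linear_combination hC)
  linear_combination key
end

section
/- (Menelaus's Theorem) Let A, B, C be three affinely independent points in the Euclidean plane, and let ℓ be a line not passing through any of A, B, C and not parallel to any of the lines BC, AC, AB. Let X = ℓ ∩ line BC, Y = ℓ ∩ line AC, Z = ℓ ∩ line AB. Then dist(B,X) · dist(C,Y) · dist(A,Z) = dist(C,X) · dist(A,Y) · dist(B,Z). -/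
/-- If an affine function vanishes at a point `X` of the line `BC`, the distances from `X` to `B`
and `C` are proportional to the absolute values of the function there. -/
theorem AffineMap.dist_mul_abs_eq_of_collinear {E : Type*} [NormedAddCommGroup E]
    [NormedSpace ℝ E] (f : E →ᵃ[ℝ] ℝ) {B C X : E} (hBC : B ≠ C) (hX : f X = 0)
    (h : Collinear ℝ ({B, C, X} : Set E)) :
    dist B X * |f C| = dist C X * |f B| := by
  have hmem : X ∈ affineSpan ℝ ({B, C} : Set E) :=
    h.mem_affineSpan_of_mem_of_ne (by simp) (by simp) (by simp) hBC
  obtain ⟨t, rfl⟩ := mem_affineSpan_pair_iff_exists_lineMap_eq.1 hmem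
  rw [AffineMap.apply_lineMap, AffineMap.lineMap_apply_ring'] at hX
  have key : |t| * |f C| = |1 - t| * |f B| := by
    rw [← abs_mul, ← abs_mul, show t * f C = -((1 - t) * f B) by linarith, abs_neg]
  rw [dist_left_lineMap, dist_right_lineMap, Real.norm_eq_abs, Real.norm_eq_abs, dist_comm B C]
  linear_combination dist C B * key

/-- A line in the complex plane is the zero set of an affine function. -/
theorem Complex.exists_affineMap_eq_zero_iff_mem_line {U V : ℂ} (hUV : U ≠ V) :
    ∃ f : ℂ →ᵃ[ℝ] ℝ, ∀ P, f P = 0 ↔ P ∈ affineSpan ℝ ({U, V} : Set ℂ) := by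
  have hne : V - U ≠ 0 := sub_ne_zero.2 hUV.symm
  refine ⟨(Complex.imLm ∘ₗ LinearMap.mulRight ℝ (V - U)⁻¹).toAffineMap.comp
    (AffineMap.id ℝ ℂ - AffineMap.const ℝ ℂ U), fun P => ?_⟩
  have hf : ((Complex.imLm ∘ₗ LinearMap.mulRight ℝ (V - U)⁻¹).toAffineMap.comp
    (AffineMap.id ℝ ℂ - AffineMap.const ℝ ℂ U)) P = ((P - U) * (V - U)⁻¹).im := rfl
  rw [hf, mem_affineSpan_pair_iff_exists_lineMap_eq]
  constructor
  · intro h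
    refine ⟨((P - U) * (V - U)⁻¹).re, ?_⟩
    have hre : ((((P - U) * (V - U)⁻¹).re : ℝ) : ℂ) = (P - U) * (V - U)⁻¹ :=
      Complex.ext rfl (by rw [h, Complex.ofReal_im])
    rw [AffineMap.lineMap_apply_module', Complex.real_smul, hre, inv_mul_cancel_right₀ hne,
      sub_add_cancel]
  · rintro ⟨r, rfl⟩
    rw [AffineMap.lineMap_apply_module', add_sub_cancel_right, Complex.real_smul,
      mul_inv_cancel_right₀ hne, Complex.ofReal_im]

/-- **Menelaus's Theorem.** Let `A, B, C` be affinely independent and let `ℓ` be a line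
(the line through two distinct points `U, V`) passing through none of `A, B, C`, meeting
line `BC` in `X`, line `AC` in `Y`, and line `AB` in `Z`. Then
`BX ⬝ CY ⬝ AZ = CX ⬝ AY ⬝ BZ` (unsigned lengths). -/
theorem menelaus (A B C U V X Y Z : ℂ)
    (h : AffineIndependent ℝ ![A, B, C]) (hUV : U ≠ V)
    -- the transversal `ℓ = line UV` avoids the vertices:
    (hA : A ∉ affineSpan ℝ ({U, V} : Set ℂ))
    (hB : B ∉ affineSpan ℝ ({U, V} : Set ℂ))
    (hC : C ∉ affineSpan ℝ ({U, V} : Set ℂ))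
    -- `X = ℓ ∩ line BC`, `Y = ℓ ∩ line AC`, `Z = ℓ ∩ line AB`:
    (hX : X ∈ affineSpan ℝ ({U, V} : Set ℂ) ∧ Collinear ℝ ({B, C, X} : Set ℂ))
    (hY : Y ∈ affineSpan ℝ ({U, V} : Set ℂ) ∧ Collinear ℝ ({A, C, Y} : Set ℂ))
    (hZ : Z ∈ affineSpan ℝ ({U, V} : Set ℂ) ∧ Collinear ℝ ({A, B, Z} : Set ℂ)) :
    dist B X * dist C Y * dist A Z = dist C X * dist A Y * dist B Z := by
  obtain ⟨f, hf⟩ := Complex.exists_affineMap_eq_zero_iff_mem_line hUV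
  have hAB : A ≠ B := h.injective.ne (show (0 : Fin 3) ≠ 1 by decide)
  have hAC : A ≠ C := h.injective.ne (show (0 : Fin 3) ≠ 2 by decide)
  have hBC : B ≠ C := h.injective.ne (show (1 : Fin 3) ≠ 2 by decide)
  have eX := f.dist_mul_abs_eq_of_collinear hBC ((hf X).2 hX.1) hX.2
  have eY := f.dist_mul_abs_eq_of_collinear hAC ((hf Y).2 hY.1) hY.2
  have eZ := f.dist_mul_abs_eq_of_collinear hAB ((hf Z).2 hZ.1) hZ.2
  have nA : |f A| ≠ 0 := abs_ne_zero.2 (mt (hf A).1 hA)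
  have nB : |f B| ≠ 0 := abs_ne_zero.2 (mt (hf B).1 hB)
  have nC : |f C| ≠ 0 := abs_ne_zero.2 (mt (hf C).1 hC)
  apply mul_right_cancel₀ (mul_ne_zero (mul_ne_zero nA nB) nC)
  calc dist B X * dist C Y * dist A Z * (|f A| * |f B| * |f C|)
      = (dist B X * |f C|) * (dist C Y * |f A|) * (dist A Z * |f B|) := by ring
    _ = (dist C X * |f B|) * (dist A Y * |f C|) * (dist B Z * |f A|) := by rw [eX, eY, eZ]
    _ = dist C X * dist A Y * dist B Z * (|f A| * |f B| * |f C|) := by ring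
end

section
/- (Euler's Triangle Formula) Let A, B, C be three affinely independent points in the Euclidean plane, let R be the circumradius, r the inradius, I the incenter, and O the circumcenter of triangle ABC, and let d = dist(I, O). Then d² = R² − 2Rr (equivalently, (d² − R²)² = 4r²R²). -/
/-- The cross product of `Q - P` and `X - P`, twice the signed area of the triangle `P Q X`. -/
def crossAt (P Q X : ℂ) : ℝ :=
  (Q.re - P.re) * (X.im - P.im) - (Q.im - P.im) * (X.re - P.re)

lemma Complex.dist_sq_eq_re_im (z w : ℂ) :
    dist z w ^ 2 = (z.re - w.re) ^ 2 + (z.im - w.im) ^ 2 := by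
  rw [Complex.dist_eq_re_im, Real.sq_sqrt (by positivity)]

lemma infDist_affineSpan_pair_mul_dist (P Q X : ℂ) :
    Metric.infDist X (affineSpan ℝ ({P, Q} : Set ℂ) : Set ℂ) * dist P Q = |crossAt P Q X| := by
  set L := affineSpan ℝ ({P, Q} : Set ℂ)
  have hP : P ∈ L := left_mem_affineSpan_pair ℝ P Q
  have hQ : Q ∈ L := right_mem_affineSpan_pair ℝ P Q
  have : Nonempty L := ⟨⟨P, hP⟩⟩
  rw [← EuclideanGeometry.dist_orthogonalProjection_eq_infDist L X]
  obtain ⟨Y, hY⟩ : ∃ Y : ℂ, Y = (EuclideanGeometry.orthogonalProjection L X : ℂ) := ⟨_, rfl⟩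
  have hYL : Y ∈ L := hY ▸ EuclideanGeometry.orthogonalProjection_mem X
  have horth : inner ℝ (Q - P) (X - Y) = 0 := by
    rw [hY]
    exact EuclideanGeometry.vsub_orthogonalProjection_mem_direction_orthogonal L X _
      (AffineSubspace.vsub_mem_direction hQ hP)
  rw [← hY]
  obtain ⟨t, rfl⟩ := mem_affineSpan_pair_iff_exists_lineMap_eq.1 hYL
  rw [← abs_of_nonneg (mul_nonneg dist_nonneg dist_nonneg), ← sq_eq_sq_iff_abs_eq_abs, mul_pow,
    Complex.dist_sq_eq_re_im, Complex.dist_sq_eq_re_im]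
  simp only [Complex.inner, AffineMap.lineMap_apply, crossAt] at horth ⊢
  simp at horth ⊢
  linear_combination
    ((Q.re - P.re) * (X.re - (t * (Q.re - P.re) + P.re)) +
      (Q.im - P.im) * (X.im - (t * (Q.im - P.im) + P.im))) * horth

lemma crossAt_sub_of_mem {P Q Y : ℂ} (hY : Y ∈ affineSpan ℝ ({P, Q} : Set ℂ)) (X : ℂ) :
    crossAt P Q X = (Q.re - P.re) * (X - Y).im - (Q.im - P.im) * (X - Y).re := by
  obtain ⟨t, rfl⟩ := mem_affineSpan_pair_iff_exists_lineMap_eq.1 hY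
  simp [crossAt, AffineMap.lineMap_apply]
  ring

lemma crossAt_mul_nonneg_of_wSameSide {P Q X Y : ℂ}
    (h : (affineSpan ℝ ({P, Q} : Set ℂ)).WSameSide X Y) :
    0 ≤ crossAt P Q X * crossAt P Q Y := by
  obtain ⟨p, hp, q, hq, hray⟩ := h
  rw [crossAt_sub_of_mem hp, crossAt_sub_of_mem hq]
  obtain ⟨u, a, b, ha, hb, -, hX, hY⟩ := hray.exists_eq_smul
  rw [vsub_eq_sub] at hX hY
  rw [hX, hY]
  have key := mul_nonneg (mul_nonneg ha hb)
    (sq_nonneg ((Q.re - P.re) * u.im - (Q.im - P.im) * u.re))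
  simp only [Complex.smul_re, Complex.smul_im, smul_eq_mul]
  linarith

lemma crossAt_ne_zero {P Q X : ℂ} (hPQ : P ≠ Q)
    (hX : X ∉ affineSpan ℝ ({P, Q} : Set ℂ)) : crossAt P Q X ≠ 0 := by
  have hclosed : IsClosed (affineSpan ℝ ({P, Q} : Set ℂ) : Set ℂ) :=
    AffineSubspace.closed_of_finiteDimensional _
  have hpos := (hclosed.notMem_iff_infDist_pos ⟨P, left_mem_affineSpan_pair ℝ P Q⟩).mp hX
  rw [← abs_pos, ← infDist_affineSpan_pair_mul_dist]
  exact mul_pos hpos (dist_pos.mpr hPQ)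

/-- The relation `abc = 4 R Δ`, squared. -/
lemma four_mul_circumradius_sq_mul_crossAt_sq {A B C O : ℂ} {R : ℝ}
    (hA : dist O A = R) (hB : dist O B = R) (hC : dist O C = R) :
    4 * R ^ 2 * crossAt A B C ^ 2 = (dist B C * dist C A * dist A B) ^ 2 := by
  have hA' := Complex.dist_sq_eq_re_im O A
  have hB' := Complex.dist_sq_eq_re_im O B
  have hC' := Complex.dist_sq_eq_re_im O C
  rw [hA] at hA'
  rw [hB] at hB'
  rw [hC] at hC'
  have gram (P Q : ℂ) (hP : R ^ 2 = (O.re - P.re) ^ 2 + (O.im - P.im) ^ 2)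
      (hQ : R ^ 2 = (O.re - Q.re) ^ 2 + (O.im - Q.im) ^ 2) :
      (O.re - P.re) * (O.re - Q.re) + (O.im - P.im) * (O.im - Q.im) - R ^ 2
        = -dist P Q ^ 2 / 2 := by
    rw [Complex.dist_sq_eq_re_im]
    linear_combination (-1 / 2) * hP - (1 / 2) * hQ
  have hAA := gram A A hA' hA'
  have hBB := gram B B hB' hB'
  have hCC := gram C C hC' hC'
  have hAB := gram A B hA' hB'
  have hBC := gram B C hB' hC'
  have hCA := gram C A hC' hA'
  rw [dist_self] at hAA hBB hCC
  -- The Gram determinant of the vectors `(O - P, R)` for the form of signature `(2, 1)`.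
  have det (x₁ y₁ x₂ y₂ x₃ y₃ : ℝ) :
      -(R ^ 2 * ((x₂ - x₁) * (y₃ - y₁) - (y₂ - y₁) * (x₃ - x₁)) ^ 2) =
        (x₁ * x₁ + y₁ * y₁ - R ^ 2) * (x₂ * x₂ + y₂ * y₂ - R ^ 2) * (x₃ * x₃ + y₃ * y₃ - R ^ 2)
        + 2 * (x₁ * x₂ + y₁ * y₂ - R ^ 2) * (x₂ * x₃ + y₂ * y₃ - R ^ 2)
          * (x₃ * x₁ + y₃ * y₁ - R ^ 2)
        - (x₁ * x₁ + y₁ * y₁ - R ^ 2) * (x₂ * x₃ + y₂ * y₃ - R ^ 2) ^ 2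
        - (x₂ * x₂ + y₂ * y₂ - R ^ 2) * (x₃ * x₁ + y₃ * y₁ - R ^ 2) ^ 2
        - (x₃ * x₃ + y₃ * y₃ - R ^ 2) * (x₁ * x₂ + y₁ * y₂ - R ^ 2) ^ 2 := by
    ring
  have key := det (O.re - A.re) (O.im - A.im) (O.re - B.re) (O.im - B.im)
    (O.re - C.re) (O.im - C.im)
  rw [hAA, hBB, hCC, hAB, hBC, hCA] at key
  rw [crossAt]
  linear_combination -4 * key

/-- The barycentric formula for the distance of a point `I` to the circumcenter. -/
lemma crossAt_sq_mul_dist_sq {A B C O I : ℂ} {R : ℝ}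
    (hA : dist O A = R) (hB : dist O B = R) (hC : dist O C = R) :
    crossAt A B C ^ 2 * dist I O ^ 2 = crossAt A B C ^ 2 * R ^ 2
      - (crossAt B C I * crossAt C A I * dist A B ^ 2
        + crossAt C A I * crossAt A B I * dist B C ^ 2
        + crossAt A B I * crossAt B C I * dist C A ^ 2) := by
  have hA' := Complex.dist_sq_eq_re_im O A
  have hB' := Complex.dist_sq_eq_re_im O B
  have hC' := Complex.dist_sq_eq_re_im O C
  rw [hA] at hA'
  rw [hB] at hB'
  rw [hC] at hC'
  simp only [Complex.dist_sq_eq_re_im]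
  have hsum : crossAt A B C = crossAt B C I + crossAt C A I + crossAt A B I := by
    simp only [crossAt]; ring
  have hre : crossAt A B C * (I.re - O.re) = crossAt B C I * (A.re - O.re)
      + crossAt C A I * (B.re - O.re) + crossAt A B I * (C.re - O.re) := by
    simp only [crossAt]; ring
  have him : crossAt A B C * (I.im - O.im) = crossAt B C I * (A.im - O.im)
      + crossAt C A I * (B.im - O.im) + crossAt A B I * (C.im - O.im) := by
    simp only [crossAt]; ring
  rw [mul_add, ← mul_pow, ← mul_pow, hre, him]
  generalize crossAt B C I = α at *
  generalize crossAt C A I = β at *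
  generalize crossAt A B I = γ at *
  rw [hsum]
  linear_combination (-(α + β + γ)) * (α * hA' + β * hB' + γ * hC')

/-- **Euler's Triangle Formula.** For a triangle with affinely independent vertices
`A, B, C`, circumcenter `O` with circumradius `R`, and incenter `I` (the point inside
the triangle at the common distance `r` — the inradius — from the three side lines),
the distance `d = dist I O` satisfies `d² = R² - 2Rr`. -/
theorem euler_triangle_formula (A B C O I : ℂ) (R r : ℝ)
    (h : AffineIndependent ℝ ![A, B, C])
    -- `O` is the circumcenter, `R` the circumradius:
    (hO : dist O A = R ∧ dist O B = R ∧ dist O C = R)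
    -- the incenter `I` lies strictly inside the triangle:
    (hI : (affineSpan ℝ ({B, C} : Set ℂ)).SSameSide I A ∧
          (affineSpan ℝ ({C, A} : Set ℂ)).SSameSide I B ∧
          (affineSpan ℝ ({A, B} : Set ℂ)).SSameSide I C)
    -- and is at the same distance `r` (the inradius) from the three side lines:
    (hr : Metric.infDist I (affineSpan ℝ ({B, C} : Set ℂ) : Set ℂ) = r ∧
          Metric.infDist I (affineSpan ℝ ({C, A} : Set ℂ) : Set ℂ) = r ∧
          Metric.infDist I (affineSpan ℝ ({A, B} : Set ℂ) : Set ℂ) = r) :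
    dist I O ^ 2 = R ^ 2 - 2 * R * r := by
  obtain ⟨hOA, hOB, hOC⟩ := hO
  obtain ⟨hIA, hIB, hIC⟩ := hI
  obtain ⟨hrA, hrB, hrC⟩ := hr
  have hne (i j : Fin 3) (hij : i ≠ j) : ![A, B, C] i ≠ ![A, B, C] j := h.injective.ne hij
  have hAB : A ≠ B := hne 0 1 (by decide)
  have hBC : B ≠ C := hne 1 2 (by decide)
  have hCA : C ≠ A := hne 2 0 (by decide)
  have hS : crossAt A B C ≠ 0 := crossAt_ne_zero hAB hIC.2.2
  have hα := infDist_affineSpan_pair_mul_dist B C I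
  have hβ := infDist_affineSpan_pair_mul_dist C A I
  have hγ := infDist_affineSpan_pair_mul_dist A B I
  rw [hrA] at hα
  rw [hrB] at hβ
  rw [hrC] at hγ
  have hα' := crossAt_mul_nonneg_of_wSameSide hIA.1
  have hβ' := crossAt_mul_nonneg_of_wSameSide hIB.1
  have hγ' := crossAt_mul_nonneg_of_wSameSide hIC.1
  rw [show crossAt B C A = crossAt A B C by simp only [crossAt]; ring] at hα'
  rw [show crossAt C A B = crossAt A B C by simp only [crossAt]; ring] at hβ'
  have hsum : crossAt A B C = crossAt B C I + crossAt C A I + crossAt A B I := by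
    simp only [crossAt]; ring
  have hbary := crossAt_sq_mul_dist_sq (I := I) hOA hOB hOC
  have harea := four_mul_circumradius_sq_mul_crossAt_sq hOA hOB hOC
  have hR : 0 ≤ R := hOA ▸ dist_nonneg
  have ha := dist_nonneg (x := B) (y := C)
  have hb := dist_nonneg (x := C) (y := A)
  have hc := dist_nonneg (x := A) (y := B)
  generalize dist B C = a at *
  generalize dist C A = b at *
  generalize dist A B = c at *
  generalize crossAt B C I = α at *
  generalize crossAt C A I = β at *
  generalize crossAt A B I = γ at *
  generalize crossAt A B C = S at *
  obtain ⟨ε, hε, hεS⟩ : ∃ ε : ℝ, ε ^ 2 = 1 ∧ ∀ x, 0 ≤ x * S → x = ε * |x| := by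
    rcases lt_or_gt_of_ne hS with hneg | hpos
    · refine ⟨-1, by norm_num, fun x hx => ?_⟩
      rw [abs_of_nonpos (nonpos_of_mul_nonneg_left hx hneg)]; ring
    · refine ⟨1, by norm_num, fun x hx => ?_⟩
      rw [abs_of_nonneg (nonneg_of_mul_nonneg_left hx hpos)]; ring
  have h₁ : α = ε * (r * a) := hα ▸ hεS α hα'
  have h₂ : β = ε * (r * b) := hβ ▸ hεS β hβ'
  have h₃ : γ = ε * (r * c) := hγ ▸ hεS γ hγ'
  have hS_abs : S = ε * |S| := hεS S (mul_self_nonneg S)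
  have harea' : 2 * R * |S| = a * b * c := by
    rw [← sq_eq_sq₀ (by positivity) (by positivity), mul_pow, sq_abs]
    linear_combination harea
  have hS_r : |S| = r * (a + b + c) := by
    linear_combination (-|S| + r * (a + b + c)) * hε + ε * (-hS_abs + hsum + h₁ + h₂ + h₃)
  refine mul_left_cancel₀ (pow_ne_zero 2 hS) ?_
  rw [hbary, h₁, h₂, h₃, ← sq_abs S]
  linear_combination (-(r ^ 2 * a * b * c * (a + b + c))) * hε
    + r * |S| * harea' + r * a * b * c * hS_r
end

section
/- (Pappus's Hexagon Theorem) Let ℓ and ℓ' be two distinct lines in the Euclidean plane, with points P₁, P₂, P₃ on ℓ and Q₁, Q₂, Q₃ on ℓ'. Assume the three pairs of lines (P₁Q₂, P₂Q₁), (P₁Q₃, P₃Q₁), (P₂Q₃, P₃Q₂) each intersect in a unique point, and call these intersection points X, Y, Z respectively. Then X, Y, Z are collinear. -/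
/-- The signed area of the parallelogram spanned by `b - a` and `c - a`. -/
def planeCross (a b c : ℂ) : ℝ :=
  (b.re - a.re) * (c.im - a.im) - (b.im - a.im) * (c.re - a.re)

theorem collinear_iff_exists_eq_add_mul {a b : ℂ} (hab : a ≠ b) (c : ℂ) :
    Collinear ℝ ({a, b, c} : Set ℂ) ↔ ∃ t : ℝ, c = a + t * (b - a) := by
  constructor
  · intro h
    have hc : c ∈ line[ℝ, a, b] :=
      h.mem_affineSpan_of_mem_of_ne (by simp) (by simp) (by simp) hab
    obtain ⟨t, rfl⟩ := mem_affineSpan_pair_iff_exists_lineMap_eq.1 hc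
    exact ⟨t, by simp [AffineMap.lineMap_apply, add_comm]⟩
  · rintro ⟨t, rfl⟩
    refine (collinear_iff_of_mem (p₀ := a) (by simp)).2 ⟨b - a, ?_⟩
    rintro p (rfl | rfl | rfl)
    · exact ⟨0, by simp⟩
    · exact ⟨1, by simp⟩
    · exact ⟨t, by simp [add_comm]⟩

theorem collinear_iff_planeCross_eq_zero (a b c : ℂ) :
    Collinear ℝ ({a, b, c} : Set ℂ) ↔ planeCross a b c = 0 := by
  rcases eq_or_ne a b with rfl | hab
  · simp [planeCross, collinear_pair]
  rw [collinear_iff_exists_eq_add_mul hab]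
  constructor
  · rintro ⟨t, rfl⟩
    simp only [planeCross, Complex.add_re, Complex.add_im, Complex.re_ofReal_mul,
      Complex.im_ofReal_mul, Complex.sub_re, Complex.sub_im]
    ring
  · intro h
    unfold planeCross at h
    by_cases hre : b.re - a.re = 0
    · have him : b.im - a.im ≠ 0 := fun him =>
        hab (Complex.ext (by linarith) (by linarith))
      refine ⟨(c.im - a.im) / (b.im - a.im), Complex.ext ?_ ?_⟩
      · simp only [Complex.add_re, Complex.re_ofReal_mul, Complex.sub_re]
        field_simp
        linear_combination -h
      · simp only [Complex.add_im, Complex.im_ofReal_mul, Complex.sub_im]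
        field_simp
        ring
    · refine ⟨(c.re - a.re) / (b.re - a.re), Complex.ext ?_ ?_⟩
      · simp only [Complex.add_re, Complex.re_ofReal_mul, Complex.sub_re]
        field_simp
        ring
      · simp only [Complex.add_im, Complex.im_ofReal_mul, Complex.sub_im]
        field_simp
        linear_combination h

/-- The determinant of the direction vectors of the lines `ab` and `cd`. -/
def directionDet (a b c d : ℂ) : ℝ :=
  (b.re - a.re) * (d.im - c.im) - (b.im - a.im) * (d.re - c.re)

theorem directionDet_ne_zero_of_unique {a b c d x : ℂ} (hab : a ≠ b)
    (hx : Collinear ℝ ({a, b, x} : Set ℂ) ∧ Collinear ℝ ({c, d, x} : Set ℂ))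
    (hu : ∀ w : ℂ, Collinear ℝ ({a, b, w} : Set ℂ) →
      Collinear ℝ ({c, d, w} : Set ℂ) → w = x) :
    directionDet a b c d ≠ 0 := by
  simp only [collinear_iff_planeCross_eq_zero, planeCross] at hx hu
  intro h
  unfold directionDet at h
  have hw := hu (x + (b - a))
    (by simp only [Complex.add_re, Complex.add_im, Complex.sub_re, Complex.sub_im]
        linear_combination hx.1)
    (by simp only [Complex.add_re, Complex.add_im, Complex.sub_re, Complex.sub_im]
        linear_combination hx.2 - h)
  exact hab (sub_eq_zero.1 (add_eq_left.1 hw)).symm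

/-- Cramer's rule for the intersection of the lines `ab` and `cd`, relative to the origin `o`. -/
theorem directionDet_mul_sub_of_collinear (o : ℂ) {a b c d x : ℂ}
    (hx : Collinear ℝ ({a, b, x} : Set ℂ) ∧ Collinear ℝ ({c, d, x} : Set ℂ)) :
    directionDet a b c d * (x.re - o.re) =
        directionDet a b c d * (a.re - o.re) + directionDet a c c d * (b.re - a.re) ∧
      directionDet a b c d * (x.im - o.im) =
        directionDet a b c d * (a.im - o.im) + directionDet a c c d * (b.im - a.im) := by
  simp only [collinear_iff_planeCross_eq_zero, planeCross] at hx
  obtain ⟨h₁, h₂⟩ := hx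
  unfold directionDet
  constructor
  · linear_combination (d.re - c.re) * h₁ - (b.re - a.re) * h₂
  · linear_combination (d.im - c.im) * h₁ - (b.im - a.im) * h₂

theorem mul_planeCross_eq_det (p q r : ℝ) (o x y z : ℂ) :
    p * q * r * planeCross x y z =
      p * ((q * (y.re - o.re)) * (r * (z.im - o.im)) -
        (q * (y.im - o.im)) * (r * (z.re - o.re))) -
      q * ((p * (x.re - o.re)) * (r * (z.im - o.im)) -
        (p * (x.im - o.im)) * (r * (z.re - o.re))) +
      r * ((p * (x.re - o.re)) * (q * (y.im - o.im)) -
        (p * (x.im - o.im)) * (q * (y.re - o.re))) := by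
  unfold planeCross
  ring

/-- **Pappus's Hexagon Theorem.** Let `P₁, P₂, P₃` lie on one line and `Q₁, Q₂, Q₃` on
another line (the six points pairwise distinct and not all on a single line, so the two
lines are distinct). If the pairs of lines `(P₁Q₂, P₂Q₁)`, `(P₁Q₃, P₃Q₁)`,
`(P₂Q₃, P₃Q₂)` meet in unique points `X`, `Y`, `Z` respectively, then `X, Y, Z` are
collinear. -/
theorem pappus (P₁ P₂ P₃ Q₁ Q₂ Q₃ X Y Z : ℂ)
    (hP : Collinear ℝ ({P₁, P₂, P₃} : Set ℂ))
    (hQ : Collinear ℝ ({Q₁, Q₂, Q₃} : Set ℂ))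
    (hdistinct : [P₁, P₂, P₃, Q₁, Q₂, Q₃].Pairwise (· ≠ ·))
    (hll : ¬ Collinear ℝ ({P₁, P₂, P₃, Q₁, Q₂, Q₃} : Set ℂ))
    -- `X` is the unique common point of lines `P₁Q₂` and `P₂Q₁`:
    (hX : Collinear ℝ ({P₁, Q₂, X} : Set ℂ) ∧ Collinear ℝ ({P₂, Q₁, X} : Set ℂ))
    (hXu : ∀ W : ℂ, Collinear ℝ ({P₁, Q₂, W} : Set ℂ) →
      Collinear ℝ ({P₂, Q₁, W} : Set ℂ) → W = X)
    -- `Y` is the unique common point of lines `P₁Q₃` and `P₃Q₁`: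
    (hY : Collinear ℝ ({P₁, Q₃, Y} : Set ℂ) ∧ Collinear ℝ ({P₃, Q₁, Y} : Set ℂ))
    (hYu : ∀ W : ℂ, Collinear ℝ ({P₁, Q₃, W} : Set ℂ) →
      Collinear ℝ ({P₃, Q₁, W} : Set ℂ) → W = Y)
    -- `Z` is the unique common point of lines `P₂Q₃` and `P₃Q₂`:
    (hZ : Collinear ℝ ({P₂, Q₃, Z} : Set ℂ) ∧ Collinear ℝ ({P₃, Q₂, Z} : Set ℂ))
    (hZu : ∀ W : ℂ, Collinear ℝ ({P₂, Q₃, W} : Set ℂ) →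
      Collinear ℝ ({P₃, Q₂, W} : Set ℂ) → W = Z) :
    Collinear ℝ ({X, Y, Z} : Set ℂ) := by
  simp only [List.pairwise_cons, List.mem_cons, List.not_mem_nil, or_false, forall_eq_or_imp,
    forall_eq] at hdistinct
  obtain ⟨⟨hP₁₂, -, -, hP₁Q₂, hP₁Q₃⟩, ⟨-, -, -, hP₂Q₃⟩, -, ⟨hQ₁₂, -⟩, -⟩ := hdistinct
  have hdX := directionDet_ne_zero_of_unique hP₁Q₂ hX hXu
  have hdY := directionDet_ne_zero_of_unique hP₁Q₃ hY hYu
  have hdZ := directionDet_ne_zero_of_unique hP₂Q₃ hZ hZu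
  obtain ⟨hXre, hXim⟩ := directionDet_mul_sub_of_collinear P₁ hX
  obtain ⟨hYre, hYim⟩ := directionDet_mul_sub_of_collinear P₁ hY
  obtain ⟨hZre, hZim⟩ := directionDet_mul_sub_of_collinear P₁ hZ
  obtain ⟨s, rfl⟩ := (collinear_iff_exists_eq_add_mul hP₁₂ P₃).1 hP
  obtain ⟨t, rfl⟩ := (collinear_iff_exists_eq_add_mul hQ₁₂ Q₃).1 hQ
  rw [collinear_iff_planeCross_eq_zero]
  refine (mul_eq_zero.1 ?_).resolve_left (mul_ne_zero (mul_ne_zero hdX hdY) hdZ)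
  rw [mul_planeCross_eq_det _ _ _ P₁, hXre, hXim, hYre, hYim, hZre, hZim]
  obtain ⟨u, rfl⟩ : ∃ u, P₂ = P₁ + u := ⟨P₂ - P₁, by ring⟩
  obtain ⟨v, rfl⟩ : ∃ v, Q₁ = P₁ + v := ⟨Q₁ - P₁, by ring⟩
  obtain ⟨w, rfl⟩ : ∃ w, Q₂ = P₁ + w := ⟨Q₂ - P₁, by ring⟩
  simp only [directionDet, Complex.add_re, Complex.add_im, Complex.re_ofReal_mul,
    Complex.im_ofReal_mul, Complex.sub_re, Complex.sub_im]
  ring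
end

section
/- (Desargues's Theorem, central perspectivity case) Let O be a point in the Euclidean plane and let ℓ₁, ℓ₂, ℓ₃ be three distinct lines through O. For i = 1,2,3 let Aᵢ and Bᵢ be points on ℓᵢ (all distinct from O and with Aᵢ ≠ Bᵢ). Assume the pairs of lines (A₁A₂, B₁B₂), (A₁A₃, B₁B₃), (A₂A₃, B₂B₃) each meet in a unique point, named X, Y, Z respectively. Then X, Y, Z are collinear. -/
/-- A point collinear with two distinct points `P` and `Q` is an affine combination of them. -/
lemma Collinear.exists_sub_eq_smul {K V : Type*} [Field K] [AddCommGroup V] [Module K V]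
    {P Q R : V} (h : Collinear K {P, Q, R}) (hPQ : Q ≠ P) : ∃ t : K, R - P = t • (Q - P) := by
  have hR : R ∈ line[K, P, Q] :=
    h.mem_affineSpan_of_mem_of_ne (by simp) (by simp) (by simp) hPQ.symm
  obtain ⟨t, rfl⟩ := mem_affineSpan_pair_iff_exists_lineMap_eq.1 hR
  exact ⟨t, by simp [AffineMap.lineMap_apply]⟩

/-- Three points `P`, `Q`, `R` with `R - P` a multiple of `Q - P` are collinear. -/
lemma collinear_of_sub_eq_smul {K V : Type*} [Field K] [AddCommGroup V] [Module K V]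
    {P Q R : V} {t : K} (h : R - P = t • (Q - P)) : Collinear K {P, Q, R} := by
  refine (collinear_iff_of_mem (p₀ := P) (by simp)).2 ⟨Q - P, ?_⟩
  rintro p (rfl | rfl | rfl)
  · exact ⟨0, by simp⟩
  · exact ⟨1, by simp⟩
  · exact ⟨t, by simp [← h]⟩

lemma linearIndependent_sub_of_not_collinear {K V : Type*} [Field K] [AddCommGroup V] [Module K V]
    {O P Q : V} (h : ¬ Collinear K {O, P, Q}) : LinearIndependent K ![P - O, Q - O] := by
  have hPO : P - O ≠ 0 := fun h0 ↦ h (by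
    rw [sub_eq_zero.1 h0]; simpa using collinear_pair K O Q)
  refine (LinearIndependent.pair_iff' hPO).2 fun t ht ↦ h (collinear_of_sub_eq_smul ht.symm)

/-- If `B₁ - O = b₁ (A₁ - O)` and `B₂ - O = b₂ (A₂ - O)`, the intersection `X` of the lines
`A₁A₂` and `B₁B₂` satisfies `(c₁ - c₂) (X - O) = c₁ (A₁ - O) - c₂ (A₂ - O)`
with `cᵢ = bᵢ / (1 - bᵢ)`, and `c₁ ≠ c₂`. -/
lemma smul_sub_eq_of_perspective {K V : Type*} [Field K] [AddCommGroup V] [Module K V]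
    {O A₁ A₂ B₁ B₂ X : V} {b₁ b₂ : K} (hO : ¬ Collinear K {O, A₁, A₂})
    (h₁ : B₁ - O = b₁ • (A₁ - O)) (h₂ : B₂ - O = b₂ • (A₂ - O))
    (hb₁ : b₁ ≠ 1) (hb₂ : b₂ ≠ 1) (hB : B₁ ≠ O)
    (hA : Collinear K {A₁, A₂, X}) (hX : Collinear K {B₁, B₂, X}) :
    b₁ / (1 - b₁) ≠ b₂ / (1 - b₂) ∧
      (b₁ / (1 - b₁) - b₂ / (1 - b₂)) • (X - O) =
        (b₁ / (1 - b₁)) • (A₁ - O) - (b₂ / (1 - b₂)) • (A₂ - O) := by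
  have hli := LinearIndependent.pair_iff.1 (linearIndependent_sub_of_not_collinear hO)
  have hA₁₂ : A₂ ≠ A₁ := by
    rintro rfl
    exact hO (by simpa using collinear_pair K O A₂)
  have hb₁' : b₁ ≠ 0 := by
    rintro rfl
    exact hB (by simpa [sub_eq_zero] using h₁)
  have hB₁₂ : B₂ ≠ B₁ := by
    rintro rfl
    exact hb₁' (hli b₁ (-b₂) (by rw [neg_smul, ← h₁, ← h₂, add_neg_cancel])).1
  obtain ⟨s, hs⟩ := hA.exists_sub_eq_smul hA₁₂
  obtain ⟨t, ht⟩ := hX.exists_sub_eq_smul hB₁₂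
  have hXs : X - O = (1 - s) • (A₁ - O) + s • (A₂ - O) := by
    linear_combination (norm := module) hs
  have hXt : X - O = ((1 - t) * b₁) • (A₁ - O) + (t * b₂) • (A₂ - O) := by
    linear_combination (norm := module) ht + (1 - t) • h₁ + t • h₂
  obtain ⟨e₁, e₂⟩ := hli (1 - s - (1 - t) * b₁) (s - t * b₂) (by
    linear_combination (norm := module) hXt - hXs)
  have d₁ : 1 - b₁ ≠ 0 := sub_ne_zero.2 hb₁.symm
  have d₂ : 1 - b₂ ≠ 0 := sub_ne_zero.2 hb₂.symm
  have ht' : t * (b₁ - b₂) = b₁ - 1 := by linear_combination e₁ + e₂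
  have hc : b₁ / (1 - b₁) - b₂ / (1 - b₂) = (b₁ - b₂) / ((1 - b₁) * (1 - b₂)) := by
    field_simp
    ring
  refine ⟨fun h ↦ d₁ ?_, ?_⟩
  · rw [div_eq_div_iff d₁ d₂] at h
    linear_combination ht' - t * h
  · have k₁ : (b₁ / (1 - b₁) - b₂ / (1 - b₂)) * (1 - s) = b₁ / (1 - b₁) := by
      rw [hc]
      field_simp
      linear_combination (b₁ - b₂) * e₁ - b₁ * ht'
    have k₂ : (b₁ / (1 - b₁) - b₂ / (1 - b₂)) * s = -(b₂ / (1 - b₂)) := by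
      linear_combination -k₁
    rw [hXs, smul_add, smul_smul, smul_smul, k₁, k₂, neg_smul, ← sub_eq_add_neg]

/-- **Desargues's Theorem** (central perspectivity case). Let `ℓ₁, ℓ₂, ℓ₃` be three
distinct lines through a point `O`, and for each `i` let `Aᵢ, Bᵢ` be points on `ℓᵢ`
distinct from `O` and from each other. If the pairs of lines `(A₁A₂, B₁B₂)`,
`(A₁A₃, B₁B₃)`, `(A₂A₃, B₂B₃)` meet in unique points `X`, `Y`, `Z` respectively,
then `X, Y, Z` are collinear. -/
theorem desargues (O A₁ A₂ A₃ B₁ B₂ B₃ X Y Z : ℂ)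
    -- `Aᵢ` and `Bᵢ` lie on a common line `ℓᵢ` through `O`:
    (hl₁ : Collinear ℝ ({O, A₁, B₁} : Set ℂ))
    (hl₂ : Collinear ℝ ({O, A₂, B₂} : Set ℂ))
    (hl₃ : Collinear ℝ ({O, A₃, B₃} : Set ℂ))
    (hA : A₁ ≠ O ∧ A₂ ≠ O ∧ A₃ ≠ O)
    (hB : B₁ ≠ O ∧ B₂ ≠ O ∧ B₃ ≠ O)
    (hAB : A₁ ≠ B₁ ∧ A₂ ≠ B₂ ∧ A₃ ≠ B₃)
    -- the three lines `ℓ₁, ℓ₂, ℓ₃` are pairwise distinct: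
    (hlines : ¬ Collinear ℝ ({O, A₁, A₂} : Set ℂ) ∧
              ¬ Collinear ℝ ({O, A₁, A₃} : Set ℂ) ∧
              ¬ Collinear ℝ ({O, A₂, A₃} : Set ℂ))
    -- `X` is the unique common point of lines `A₁A₂` and `B₁B₂`:
    (hX : Collinear ℝ ({A₁, A₂, X} : Set ℂ) ∧ Collinear ℝ ({B₁, B₂, X} : Set ℂ))
    (hXu : ∀ W : ℂ, Collinear ℝ ({A₁, A₂, W} : Set ℂ) →
      Collinear ℝ ({B₁, B₂, W} : Set ℂ) → W = X)
    -- `Y` is the unique common point of lines `A₁A₃` and `B₁B₃`: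
    (hY : Collinear ℝ ({A₁, A₃, Y} : Set ℂ) ∧ Collinear ℝ ({B₁, B₃, Y} : Set ℂ))
    (hYu : ∀ W : ℂ, Collinear ℝ ({A₁, A₃, W} : Set ℂ) →
      Collinear ℝ ({B₁, B₃, W} : Set ℂ) → W = Y)
    -- `Z` is the unique common point of lines `A₂A₃` and `B₂B₃`:
    (hZ : Collinear ℝ ({A₂, A₃, Z} : Set ℂ) ∧ Collinear ℝ ({B₂, B₃, Z} : Set ℂ))
    (hZu : ∀ W : ℂ, Collinear ℝ ({A₂, A₃, W} : Set ℂ) →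
      Collinear ℝ ({B₂, B₃, W} : Set ℂ) → W = Z) :
    Collinear ℝ ({X, Y, Z} : Set ℂ) := by
  obtain ⟨b₁, h₁⟩ := hl₁.exists_sub_eq_smul hA.1
  obtain ⟨b₂, h₂⟩ := hl₂.exists_sub_eq_smul hA.2.1
  obtain ⟨b₃, h₃⟩ := hl₃.exists_sub_eq_smul hA.2.2
  have ne_one {A B : ℂ} {b : ℝ} (h : B - O = b • (A - O)) (hne : A ≠ B) : b ≠ 1 := by
    rintro rfl
    exact hne (by simpa using h.symm)
  have hb₁ := ne_one h₁ hAB.1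
  have hb₂ := ne_one h₂ hAB.2.1
  have hb₃ := ne_one h₃ hAB.2.2
  obtain ⟨-, eX⟩ := smul_sub_eq_of_perspective hlines.1 h₁ h₂ hb₁ hb₂ hB.1 hX.1 hX.2
  obtain ⟨-, eY⟩ := smul_sub_eq_of_perspective hlines.2.1 h₁ h₃ hb₁ hb₃ hB.1 hY.1 hY.2
  obtain ⟨n₂₃, eZ⟩ := smul_sub_eq_of_perspective hlines.2.2 h₂ h₃ hb₂ hb₃ hB.2.1 hZ.1 hZ.2
  generalize b₁ / (1 - b₁) = c₁ at *
  generalize b₂ / (1 - b₂) = c₂ at *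
  generalize b₃ / (1 - b₃) = c₃ at *
  have e : (c₂ - c₃) • (Z - X) = (c₁ - c₃) • (Y - X) := by
    linear_combination (norm := module) eX + eZ - eY
  refine collinear_of_sub_eq_smul (t := (c₂ - c₃)⁻¹ * (c₁ - c₃)) ?_
  rw [mul_smul, ← e, inv_smul_smul₀ (sub_ne_zero.2 n₂₃)]
end

section
/- (Pascal's Theorem for an ellipse) Let E be an ellipse in the plane with center c and semi-axes d₁, d₂ > 0, i.e. the set of points (c₁ + d₁ cos θ, c₂ + d₂ sin θ). Let P₁, P₂, P₃, Q₁, Q₂, Q₃ be six distinct points on E. Assume the pairs of lines (P₁Q₂, P₂Q₁), (P₁Q₃, P₃Q₁), (P₂Q₃, P₃Q₂) each intersect in a unique point, named X, Y, Z respectively. Then X, Y, Z are collinear. -/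
open ComplexConjugate in
/-- Three points of the complex plane are collinear iff the cross product of the two differences
vanishes. -/
theorem Complex.collinear_iff_mul_conj {A B C : ℂ} :
    Collinear ℝ ({A, B, C} : Set ℂ) ↔ (B - A) * conj (C - A) = conj (B - A) * (C - A) := by
  rw [collinear_iff_of_mem (p₀ := A) (by simp)]
  constructor
  · rintro ⟨v, hv⟩
    obtain ⟨r, rfl⟩ := hv B (by simp)
    obtain ⟨s, rfl⟩ := hv C (by simp)
    simp
    ring
  · intro h
    by_cases hBA : B - A = 0
    · refine ⟨C - A, ?_⟩
      simp only [Set.mem_insert_iff, Set.mem_singleton_iff, forall_eq_or_imp, forall_eq]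
      exact ⟨⟨0, by simp⟩, ⟨0, by simp [sub_eq_zero.mp hBA]⟩, ⟨1, by simp⟩⟩
    · refine ⟨B - A, ?_⟩
      simp only [Set.mem_insert_iff, Set.mem_singleton_iff, forall_eq_or_imp, forall_eq]
      have hreal : conj ((C - A) / (B - A)) = (C - A) / (B - A) := by
        rw [map_div₀, div_eq_div_iff ((map_ne_zero _).mpr hBA) hBA]
        linear_combination h
      obtain ⟨r, hr⟩ := Complex.conj_eq_iff_real.mp hreal
      refine ⟨⟨0, by simp⟩, ⟨1, by simp⟩, ⟨r, ?_⟩⟩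
      rw [div_eq_iff hBA] at hr
      simp only [Complex.real_smul, vadd_eq_add]
      linear_combination hr

/-- The axis-parallel scaling of the complex plane carrying the unit circle to the ellipse with
center `c` and semi-axes `d₁`, `d₂`. -/
def ellipseMap (c : ℂ) (d₁ d₂ : ℝ) (z : ℂ) : ℂ :=
  c + d₁ * z.re + d₂ * z.im * Complex.I

theorem ellipseMap_surjective (c : ℂ) {d₁ d₂ : ℝ} (hd₁ : d₁ ≠ 0) (hd₂ : d₂ ≠ 0) :
    Function.Surjective (ellipseMap c d₁ d₂) := fun W ↦
  ⟨⟨(W.re - c.re) / d₁, (W.im - c.im) / d₂⟩, by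
    apply Complex.ext <;> simp [ellipseMap, mul_div_cancel₀, hd₁, hd₂]⟩

theorem ellipseMap_injective (c : ℂ) {d₁ d₂ : ℝ} (hd₁ : d₁ ≠ 0) (hd₂ : d₂ ≠ 0) :
    Function.Injective (ellipseMap c d₁ d₂) := fun z w h ↦ by
  have hre := congrArg Complex.re h
  have him := congrArg Complex.im h
  simp [ellipseMap, hd₁, hd₂] at hre him
  exact Complex.ext hre him

theorem collinear_ellipseMap_iff (c : ℂ) {d₁ d₂ : ℝ} (hd₁ : d₁ ≠ 0) (hd₂ : d₂ ≠ 0) {x y z : ℂ} :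
    Collinear ℝ ({ellipseMap c d₁ d₂ x, ellipseMap c d₁ d₂ y, ellipseMap c d₁ d₂ z} : Set ℂ) ↔
      Collinear ℝ ({x, y, z} : Set ℂ) := by
  rw [Complex.collinear_iff_mul_conj, Complex.collinear_iff_mul_conj, Complex.ext_iff,
    Complex.ext_iff]
  simp only [ellipseMap, map_sub, Complex.mul_re, Complex.mul_im, Complex.sub_re, Complex.sub_im,
    Complex.add_re, Complex.add_im, Complex.conj_re, Complex.conj_im, Complex.ofReal_re,
    Complex.ofReal_im, Complex.I_re, Complex.I_im]
  refine and_congr (iff_of_true (by ring) (by ring)) ⟨fun h ↦ ?_, fun h ↦ ?_⟩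
  · apply mul_left_cancel₀ (mul_ne_zero hd₁ hd₂)
    linear_combination h
  · linear_combination d₁ * d₂ * h

section UnitCircle

open ComplexConjugate

/-- The equation of the chord of the unit circle through `p` and `q`. -/
theorem collinear_chord_iff {p q x : ℂ} (hp : p * conj p = 1) (hq : q * conj q = 1)
    (hpq : p ≠ q) :
    Collinear ℝ ({p, q, x} : Set ℂ) ↔ x + p * q * conj x = p + q := by
  have hp0 : p ≠ 0 := left_ne_zero_of_mul_eq_one hp
  have hq0 : q ≠ 0 := left_ne_zero_of_mul_eq_one hq
  rw [Complex.collinear_iff_mul_conj, map_sub, map_sub, eq_inv_of_mul_eq_one_right hp,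
    eq_inv_of_mul_eq_one_right hq]
  constructor
  · intro h
    apply mul_left_cancel₀ (sub_ne_zero.mpr hpq)
    field_simp at h
    linear_combination -h
  · intro h
    field_simp
    linear_combination (q - p) * h

/-- If two chords of the unit circle meet in exactly one point, then they are not parallel. -/
theorem mul_ne_mul_of_unique_inter {p q r s x : ℂ} (hp : p * conj p = 1) (hq : q * conj q = 1)
    (hr : r * conj r = 1) (hs : s * conj s = 1) (hpq : p ≠ q) (hrs : r ≠ s)
    (hx : x + p * q * conj x = p + q) (hx' : x + r * s * conj x = r + s)
    (hu : ∀ w : ℂ, Collinear ℝ ({p, q, w} : Set ℂ) → Collinear ℝ ({r, s, w} : Set ℂ) → w = x) :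
    p * q ≠ r * s := by
  intro h
  have hdir : (p - q) + p * q * conj (p - q) = 0 := by
    rw [map_sub]
    linear_combination q * hp - p * hq
  have := hu (x + (p - q))
    ((collinear_chord_iff hp hq hpq).mpr (by rw [map_add]; linear_combination hx + hdir))
    ((collinear_chord_iff hr hs hrs).mpr (by
      rw [map_add, ← h]
      rw [← h] at hx'
      linear_combination hx' + hdir))
  exact hpq (sub_eq_zero.mp (add_eq_left.mp this))

/-- **Pascal's theorem** for the unit circle. -/
theorem pascal_unitCircle {p₁ p₂ p₃ q₁ q₂ q₃ x y z : ℂ}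
    (hx : x + p₁ * q₂ * conj x = p₁ + q₂) (hx' : x + p₂ * q₁ * conj x = p₂ + q₁)
    (hy : y + p₁ * q₃ * conj y = p₁ + q₃) (hy' : y + p₃ * q₁ * conj y = p₃ + q₁)
    (hz : z + p₂ * q₃ * conj z = p₂ + q₃) (hz' : z + p₃ * q₂ * conj z = p₃ + q₂)
    (hxn : p₁ * q₂ ≠ p₂ * q₁) (hyn : p₁ * q₃ ≠ p₃ * q₁) (hzn : p₂ * q₃ ≠ p₃ * q₂) :
    Collinear ℝ ({x, y, z} : Set ℂ) := by
  have solve : ∀ {a b s t w : ℂ}, w + a * conj w = s → w + b * conj w = t → a ≠ b →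
      conj w = (s - t) / (a - b) ∧ w = (a * t - b * s) / (a - b) := by
    intro a b s t w h h' hab
    rw [eq_div_iff (sub_ne_zero.mpr hab), eq_div_iff (sub_ne_zero.mpr hab)]
    constructor
    · linear_combination h - h'
    · linear_combination a * h' - b * h
  obtain ⟨hxc, hx⟩ := solve hx hx' hxn
  obtain ⟨hyc, hy⟩ := solve hy hy' hyn
  obtain ⟨hzc, hz⟩ := solve hz hz' hzn
  rw [Complex.collinear_iff_mul_conj, map_sub, map_sub, hxc, hyc, hzc, hx, hy, hz]
  have hxn := sub_ne_zero.mpr hxn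
  have hyn := sub_ne_zero.mpr hyn
  have hzn := sub_ne_zero.mpr hzn
  rw [div_sub_div _ _ hyn hxn, div_sub_div _ _ hzn hxn, div_sub_div _ _ hyn hxn,
    div_sub_div _ _ hzn hxn, div_mul_div_comm, div_mul_div_comm]
  congr 1
  ring

end UnitCircle


/-- **Pascal's Theorem for an ellipse.** Let `P₁, P₂, P₃, Q₁, Q₂, Q₃` be six distinct
points on the ellipse with center `c` and semi-axes `d₁, d₂ > 0` (the set of points
`c + (d₁ cos θ, d₂ sin θ)`). If the pairs of lines `(P₁Q₂, P₂Q₁)`, `(P₁Q₃, P₃Q₁)`,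
`(P₂Q₃, P₃Q₂)` meet in unique points `X`, `Y`, `Z` respectively, then `X, Y, Z` are
collinear. -/
theorem pascal_ellipse (c : ℂ) (d₁ d₂ : ℝ) (hd₁ : 0 < d₁) (hd₂ : 0 < d₂)
    (α₁ α₂ α₃ β₁ β₂ β₃ : ℝ) (P₁ P₂ P₃ Q₁ Q₂ Q₃ X Y Z : ℂ)
    (hP₁ : P₁ = c + d₁ * Real.cos α₁ + d₂ * Real.sin α₁ * Complex.I)
    (hP₂ : P₂ = c + d₁ * Real.cos α₂ + d₂ * Real.sin α₂ * Complex.I)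
    (hP₃ : P₃ = c + d₁ * Real.cos α₃ + d₂ * Real.sin α₃ * Complex.I)
    (hQ₁ : Q₁ = c + d₁ * Real.cos β₁ + d₂ * Real.sin β₁ * Complex.I)
    (hQ₂ : Q₂ = c + d₁ * Real.cos β₂ + d₂ * Real.sin β₂ * Complex.I)
    (hQ₃ : Q₃ = c + d₁ * Real.cos β₃ + d₂ * Real.sin β₃ * Complex.I)
    (hdistinct : [P₁, P₂, P₃, Q₁, Q₂, Q₃].Pairwise (· ≠ ·))
    -- `X` is the unique common point of lines `P₁Q₂` and `P₂Q₁`: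
    (hX : Collinear ℝ ({P₁, Q₂, X} : Set ℂ) ∧ Collinear ℝ ({P₂, Q₁, X} : Set ℂ))
    (hXu : ∀ W : ℂ, Collinear ℝ ({P₁, Q₂, W} : Set ℂ) →
      Collinear ℝ ({P₂, Q₁, W} : Set ℂ) → W = X)
    -- `Y` is the unique common point of lines `P₁Q₃` and `P₃Q₁`:
    (hY : Collinear ℝ ({P₁, Q₃, Y} : Set ℂ) ∧ Collinear ℝ ({P₃, Q₁, Y} : Set ℂ))
    (hYu : ∀ W : ℂ, Collinear ℝ ({P₁, Q₃, W} : Set ℂ) →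
      Collinear ℝ ({P₃, Q₁, W} : Set ℂ) → W = Y)
    -- `Z` is the unique common point of lines `P₂Q₃` and `P₃Q₂`:
    (hZ : Collinear ℝ ({P₂, Q₃, Z} : Set ℂ) ∧ Collinear ℝ ({P₃, Q₂, Z} : Set ℂ))
    (hZu : ∀ W : ℂ, Collinear ℝ ({P₂, Q₃, W} : Set ℂ) →
      Collinear ℝ ({P₃, Q₂, W} : Set ℂ) → W = Z) :
    Collinear ℝ ({X, Y, Z} : Set ℂ) := by
  have h₁ := hd₁.ne'
  have h₂ := hd₂.ne'
  have param (θ : ℝ) : c + d₁ * Real.cos θ + d₂ * Real.sin θ * Complex.I =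
      ellipseMap c d₁ d₂ (Complex.exp (θ * Complex.I)) := by
    simp only [ellipseMap, Complex.exp_ofReal_mul_I_re, Complex.exp_ofReal_mul_I_im]
  have unit (θ : ℝ) : Complex.exp (θ * Complex.I) * (starRingEnd ℂ) (Complex.exp (θ * Complex.I)) = 1 := by
    rw [Complex.mul_conj, Complex.normSq_eq_norm_sq, Complex.norm_exp_ofReal_mul_I]
    simp
  obtain ⟨x, rfl⟩ := ellipseMap_surjective c h₁ h₂ X
  obtain ⟨y, rfl⟩ := ellipseMap_surjective c h₁ h₂ Y
  obtain ⟨z, rfl⟩ := ellipseMap_surjective c h₁ h₂ Z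
  rw [param] at hP₁ hP₂ hP₃ hQ₁ hQ₂ hQ₃
  have hp₁ := unit α₁
  have hp₂ := unit α₂
  have hp₃ := unit α₃
  have hq₁ := unit β₁
  have hq₂ := unit β₂
  have hq₃ := unit β₃
  generalize Complex.exp (α₁ * Complex.I) = p₁ at *
  generalize Complex.exp (α₂ * Complex.I) = p₂ at *
  generalize Complex.exp (α₃ * Complex.I) = p₃ at *
  generalize Complex.exp (β₁ * Complex.I) = q₁ at *
  generalize Complex.exp (β₂ * Complex.I) = q₂ at *
  generalize Complex.exp (β₃ * Complex.I) = q₃ at *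
  subst hP₁ hP₂ hP₃ hQ₁ hQ₂ hQ₃
  rw [(ellipseMap_surjective c h₁ h₂).forall] at hXu hYu hZu
  simp only [collinear_ellipseMap_iff c h₁ h₂,
    (ellipseMap_injective c h₁ h₂).eq_iff] at hX hXu hY hYu hZ hZu ⊢
  simp only [List.pairwise_cons, List.mem_cons, List.not_mem_nil, forall_eq_or_imp, ne_eq,
    (ellipseMap_injective c h₁ h₂).eq_iff] at hdistinct
  have n₁₂ : p₁ ≠ q₂ := by tauto
  have n₁₃ : p₁ ≠ q₃ := by tauto
  have n₂₁ : p₂ ≠ q₁ := by tauto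
  have n₂₃ : p₂ ≠ q₃ := by tauto
  have n₃₁ : p₃ ≠ q₁ := by tauto
  have n₃₂ : p₃ ≠ q₂ := by tauto
  rw [collinear_chord_iff hp₁ hq₂ n₁₂, collinear_chord_iff hp₂ hq₁ n₂₁] at hX
  rw [collinear_chord_iff hp₁ hq₃ n₁₃, collinear_chord_iff hp₃ hq₁ n₃₁] at hY
  rw [collinear_chord_iff hp₂ hq₃ n₂₃, collinear_chord_iff hp₃ hq₂ n₃₂] at hZ
  exact pascal_unitCircle hX.1 hX.2 hY.1 hY.2 hZ.1 hZ.2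
    (mul_ne_mul_of_unique_inter hp₁ hq₂ hp₂ hq₁ n₁₂ n₂₁ hX.1 hX.2 hXu)
    (mul_ne_mul_of_unique_inter hp₁ hq₃ hp₃ hq₁ n₁₃ n₃₁ hY.1 hY.2 hYu)
    (mul_ne_mul_of_unique_inter hp₂ hq₃ hp₃ hq₂ n₂₃ n₃₂ hZ.1 hZ.2 hZu)
end

section
/- (Johnson's Theorem) Let C₀, C₁, C₂ be three points on a circle of radius R centered at a point O in the Euclidean plane (i.e. three circles of equal radius R passing through the common point O have centers C₀, C₁, C₂). For each pair i ≠ j, let Pᵢⱼ be the second intersection point of the circles of radius R centered at Cᵢ and Cⱼ, namely the reflection of O in the line CᵢCⱼ. Then the circumradius of the triangle P₀₁P₁₂P₂₀ equals R. -/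
open scoped RealInnerProductSpace

/-- If `O` is equidistant from distinct points `A` and `B`, its reflection in the line `AB` is the
fourth vertex `A + B - O` of the parallelogram spanned by `A` and `B` at `O`. -/
theorem eq_add_sub_of_midpoint_mem_affineSpan_pair {V : Type*} [NormedAddCommGroup V]
    [InnerProductSpace ℝ V] {O A B P : V} (hd : dist A O = dist B O) (hAB : A ≠ B)
    (hm : midpoint ℝ O P ∈ affineSpan ℝ ({A, B} : Set V)) (hi : ⟪P - O, A - B⟫ = 0) :
    P = A + B - O := by
  obtain ⟨t, ht⟩ := mem_affineSpan_pair_iff_exists_lineMap_eq.1 hm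
  have hP : P - O = ((A - O) + (B - O)) + (1 - 2 * t) • (A - B) := by
    have h2 : O + P = (2 : ℝ) • midpoint ℝ O P := by
      rw [midpoint_eq_smul_add, smul_smul]
      norm_num
    rw [← ht, AffineMap.lineMap_apply_module] at h2
    rw [eq_sub_of_add_eq' h2]
    module
  have hort : ⟪(A - O) + (B - O), A - B⟫ = 0 := by
    rw [← sub_sub_sub_cancel_right A B O, real_inner_add_sub_eq_zero_iff]
    simpa only [dist_eq_norm] using hd
  rw [hP, inner_add_left, hort, zero_add, real_inner_smul_left, mul_eq_zero, inner_self_eq_zero,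
    sub_eq_zero (a := A)] at hi
  rw [hi.resolve_right hAB, zero_smul, add_zero] at hP
  rw [eq_add_of_sub_eq hP]
  abel

/-- **Johnson's Theorem.** Let three circles of the same radius `R` pass through a
common point `O`; their centers `C₀, C₁, C₂` (assumed pairwise distinct) lie at distance
`R` from `O`. For each pair, the second intersection point of the two circles is the
reflection of `O` in the line joining their centers; call these points `P₀₁, P₁₂, P₂₀`.
Then the circumradius of the triangle `P₀₁ P₁₂ P₂₀` equals `R`: there is a point at
distance `R` from all three. -/
theorem johnson (O : ℂ) (R : ℝ) (hR : 0 < R) (C₀ C₁ C₂ P₀₁ P₁₂ P₂₀ : ℂ)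
    (hC : dist C₀ O = R ∧ dist C₁ O = R ∧ dist C₂ O = R)
    (hCd : C₀ ≠ C₁ ∧ C₁ ≠ C₂ ∧ C₂ ≠ C₀)
    -- `P₀₁` is the reflection of `O` in the line `C₀C₁`:
    (hP₀₁ : midpoint ℝ O P₀₁ ∈ affineSpan ℝ ({C₀, C₁} : Set ℂ) ∧
      ⟪P₀₁ - O, C₀ - C₁⟫ = 0)
    -- `P₁₂` is the reflection of `O` in the line `C₁C₂`:
    (hP₁₂ : midpoint ℝ O P₁₂ ∈ affineSpan ℝ ({C₁, C₂} : Set ℂ) ∧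
      ⟪P₁₂ - O, C₁ - C₂⟫ = 0)
    -- `P₂₀` is the reflection of `O` in the line `C₂C₀`:
    (hP₂₀ : midpoint ℝ O P₂₀ ∈ affineSpan ℝ ({C₂, C₀} : Set ℂ) ∧
      ⟪P₂₀ - O, C₂ - C₀⟫ = 0)
    (hind : AffineIndependent ℝ ![P₀₁, P₁₂, P₂₀]) :
    ∃ Q : ℂ, dist Q P₀₁ = R ∧ dist Q P₁₂ = R ∧ dist Q P₂₀ = R := by
  obtain ⟨h₀, h₁, h₂⟩ := hC
  have e₀₁ := eq_add_sub_of_midpoint_mem_affineSpan_pair (h₀.trans h₁.symm) hCd.1 hP₀₁.1 hP₀₁.2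
  have e₁₂ := eq_add_sub_of_midpoint_mem_affineSpan_pair (h₁.trans h₂.symm) hCd.2.1 hP₁₂.1 hP₁₂.2
  have e₂₀ := eq_add_sub_of_midpoint_mem_affineSpan_pair (h₂.trans h₀.symm) hCd.2.2 hP₂₀.1 hP₂₀.2
  rw [dist_eq_norm] at h₀ h₁ h₂
  refine ⟨C₀ + C₁ + C₂ - 2 * O, ?_, ?_, ?_⟩ <;> rw [dist_eq_norm]
  · rw [e₀₁, ← h₂]
    ring_nf
  · rw [e₁₂, ← h₀]
    ring_nf
  · rw [e₂₀, ← h₁]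
    ring_nf
end

section
/- (Descartes/Soddy Circle Theorem) Let four circles in the Euclidean plane, with centers O₁, O₂, O₃, O₄ and radii r₁, r₂, r₃, r₄ > 0, be mutually externally tangent in the configuration where three circles of radii r₂, r₃, r₄ are each externally tangent to the other two and all three are internally tangent to the circle of radius r₁ containing them (so dist(Oᵢ,Oⱼ) = rᵢ + rⱼ for 2 ≤ i < j ≤ 4 and dist(O₁,Oⱼ) = r₁ − rⱼ for j = 2,3,4). Set the curvatures e₁ = −1/r₁ and eⱼ = 1/rⱼ for j = 2,3,4. Then (e₁ + e₂ + e₃ + e₄)² = 2(e₁² + e₂² + e₃² + e₄²). -/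
theorem Complex.re_sub_sq_add_im_sub_sq_of_dist_eq {z w : ℂ} {d : ℝ} (h : dist z w = d) :
    (z.re - w.re) ^ 2 + (z.im - w.im) ^ 2 = d ^ 2 := by
  rw [← h, Complex.dist_eq_re_im, Real.sq_sqrt (by positivity)]

/-- The Gram determinant of three vectors in the plane vanishes. -/
theorem gram_det_plane_eq_zero {R : Type*} [CommRing R] (a b c d e f : R) :
    (a ^ 2 + b ^ 2) * (c ^ 2 + d ^ 2) * (e ^ 2 + f ^ 2) +
      2 * (a * c + b * d) * (a * e + b * f) * (c * e + d * f) -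
      (a ^ 2 + b ^ 2) * (c * e + d * f) ^ 2 - (c ^ 2 + d ^ 2) * (a * e + b * f) ^ 2 -
      (e ^ 2 + f ^ 2) * (a * c + b * d) ^ 2 = 0 := by
  ring

/-- **Descartes/Soddy Circle Theorem.** Let three circles with centers `O₂, O₃, O₄` and
radii `r₂, r₃, r₄ > 0` be pairwise externally tangent, and all internally tangent to a
circle with center `O₁` and radius `r₁ > 0` containing them. With curvatures
`e₁ = -1/r₁` and `eⱼ = 1/rⱼ` for `j = 2, 3, 4`, we have
`(e₁ + e₂ + e₃ + e₄)² = 2(e₁² + e₂² + e₃² + e₄²)`. -/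
theorem descartes_soddy (O₁ O₂ O₃ O₄ : ℂ) (r₁ r₂ r₃ r₄ : ℝ)
    (hr₁ : 0 < r₁) (hr₂ : 0 < r₂) (hr₃ : 0 < r₃) (hr₄ : 0 < r₄)
    -- the three small circles are pairwise externally tangent:
    (h₂₃ : dist O₂ O₃ = r₂ + r₃) (h₂₄ : dist O₂ O₄ = r₂ + r₄)
    (h₃₄ : dist O₃ O₄ = r₃ + r₄)
    -- and each is internally tangent to the enclosing circle:
    (h₁₂ : dist O₁ O₂ = r₁ - r₂) (h₁₃ : dist O₁ O₃ = r₁ - r₃)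
    (h₁₄ : dist O₁ O₄ = r₁ - r₄) :
    (-r₁⁻¹ + r₂⁻¹ + r₃⁻¹ + r₄⁻¹) ^ 2 =
      2 * ((-r₁⁻¹) ^ 2 + (r₂⁻¹) ^ 2 + (r₃⁻¹) ^ 2 + (r₄⁻¹) ^ 2) := by
  have h22 := Complex.re_sub_sq_add_im_sub_sq_of_dist_eq h₁₂
  have h33 := Complex.re_sub_sq_add_im_sub_sq_of_dist_eq h₁₃
  have h44 := Complex.re_sub_sq_add_im_sub_sq_of_dist_eq h₁₄
  have h23 := Complex.re_sub_sq_add_im_sub_sq_of_dist_eq h₂₃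
  have h24 := Complex.re_sub_sq_add_im_sub_sq_of_dist_eq h₂₄
  have h34 := Complex.re_sub_sq_add_im_sub_sq_of_dist_eq h₃₄
  have i23 : (O₂.re - O₁.re) * (O₃.re - O₁.re) + (O₂.im - O₁.im) * (O₃.im - O₁.im) =
      r₁ ^ 2 - r₁ * r₂ - r₁ * r₃ - r₂ * r₃ := by linarith
  have i24 : (O₂.re - O₁.re) * (O₄.re - O₁.re) + (O₂.im - O₁.im) * (O₄.im - O₁.im) =
      r₁ ^ 2 - r₁ * r₂ - r₁ * r₄ - r₂ * r₄ := by linarith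
  have i34 : (O₃.re - O₁.re) * (O₄.re - O₁.re) + (O₃.im - O₁.im) * (O₄.im - O₁.im) =
      r₁ ^ 2 - r₁ * r₃ - r₁ * r₄ - r₃ * r₄ := by linarith
  have i22 : (O₂.re - O₁.re) ^ 2 + (O₂.im - O₁.im) ^ 2 = (r₁ - r₂) ^ 2 := by linarith
  have i33 : (O₃.re - O₁.re) ^ 2 + (O₃.im - O₁.im) ^ 2 = (r₁ - r₃) ^ 2 := by linarith
  have i44 : (O₄.re - O₁.re) ^ 2 + (O₄.im - O₁.im) ^ 2 = (r₁ - r₄) ^ 2 := by linarith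
  have gram := gram_det_plane_eq_zero (O₂.re - O₁.re) (O₂.im - O₁.im) (O₃.re - O₁.re)
    (O₃.im - O₁.im) (O₄.re - O₁.re) (O₄.im - O₁.im)
  rw [i22, i33, i44, i23, i24, i34] at gram
  field_simp
  linarith
end

section
/- (Euler's Tetrahedron Volume Formula / Cayley–Menger determinant in dimension 3) Let P₁, P₂, P₃, P₄ be four points in Euclidean 3-space, and for i ≠ j let dᵢⱼ² denote the squared distance between Pᵢ and Pⱼ. Let V be the volume of the tetrahedron with vertices P₁, P₂, P₃, P₄. Then 288 V² equals the determinant of the 5×5 matrix with rows (0, d₁₄², d₂₄², d₃₄², 1), (d₁₄², 0, d₁₂², d₁₃², 1), (d₂₄², d₁₂², 0, d₂₃², 1), (d₃₄², d₁₃², d₂₃², 0, 1), (1, 1, 1, 1, 0). -/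
/-- The Cayley–Menger determinant of a tetrahedron in terms of the Gram matrix of the edge vectors
at one vertex. -/
lemma cayleyMenger_det_eq_gram_det {R : Type*} [CommRing R] (a b c x y z : R) :
    Matrix.det
      !![0,             c,             a + c - 2 * y, b + c - 2 * z, 1;
         c,             0,             a,             b,             1;
         a + c - 2 * y, a,             0,             a + b - 2 * x, 1;
         b + c - 2 * z, b,             a + b - 2 * x, 0,             1;
         1,             1,             1,             1,             0] =
      8 * Matrix.det !![a, x, y; x, b, z; y, z, c] := by
  simp [Matrix.det_succ_row_zero, Fin.sum_univ_succ, Fin.succAbove]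
  ring

open scoped InnerProductSpace in
/-- The squared volume determinant of three vectors is the determinant of their Gram matrix. -/
lemma det_sq_eq_gram_det (u v w : EuclideanSpace ℝ (Fin 3)) :
    Matrix.det (Matrix.of fun i j => (![u, v, w] i) j) ^ 2 =
      Matrix.det !![‖u‖ ^ 2, ⟪u, v⟫_ℝ, ⟪u, w⟫_ℝ;
                    ⟪u, v⟫_ℝ, ‖v‖ ^ 2, ⟪v, w⟫_ℝ;
                    ⟪u, w⟫_ℝ, ⟪v, w⟫_ℝ, ‖w‖ ^ 2] := by
  simp [Matrix.det_fin_three, EuclideanSpace.real_norm_sq_eq, PiLp.inner_apply, Fin.sum_univ_three]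
  ring

open scoped InnerProductSpace in
/-- The law of cosines for the triangle with vertices `P`, `Q`, `O`. -/
lemma dist_sq_eq_norm_sub_sq {E : Type*} [NormedAddCommGroup E] [InnerProductSpace ℝ E]
    (O P Q : E) :
    dist P Q ^ 2 = ‖P - O‖ ^ 2 + ‖Q - O‖ ^ 2 - 2 * ⟪P - O, Q - O⟫_ℝ := by
  rw [dist_eq_norm, ← sub_sub_sub_cancel_right P Q O, norm_sub_sq_real]
  ring


/-- **Euler's Tetrahedron Volume Formula** (Cayley–Menger determinant in dimension 3).
For points `P₁, P₂, P₃, P₄` in Euclidean 3-space with squared mutual distances `dᵢⱼ²`,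
the volume `V = |det(P₂-P₁, P₃-P₁, P₄-P₁)|/6` of the tetrahedron satisfies
`288 V² = det M` where `M` is the Cayley–Menger-type matrix below. -/
theorem euler_tetrahedron_volume (P₁ P₂ P₃ P₄ : EuclideanSpace ℝ (Fin 3)) (V : ℝ)
    (hV : V = |Matrix.det (Matrix.of fun i j =>
      (![P₂ - P₁, P₃ - P₁, P₄ - P₁] i) j)| / 6) :
    288 * V ^ 2 = Matrix.det
      !![0,               dist P₁ P₄ ^ 2, dist P₂ P₄ ^ 2, dist P₃ P₄ ^ 2, 1;
         dist P₁ P₄ ^ 2,  0,              dist P₁ P₂ ^ 2, dist P₁ P₃ ^ 2, 1;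
         dist P₂ P₄ ^ 2,  dist P₁ P₂ ^ 2, 0,              dist P₂ P₃ ^ 2, 1;
         dist P₃ P₄ ^ 2,  dist P₁ P₃ ^ 2, dist P₂ P₃ ^ 2, 0,              1;
         1,               1,              1,              1,              0] := by
  have hP (Q : EuclideanSpace ℝ (Fin 3)) : dist P₁ Q ^ 2 = ‖Q - P₁‖ ^ 2 := by
    rw [dist_comm, dist_eq_norm]
  rw [hP, hP, hP, dist_sq_eq_norm_sub_sq P₁ P₂ P₃, dist_sq_eq_norm_sub_sq P₁ P₂ P₄,
    dist_sq_eq_norm_sub_sq P₁ P₃ P₄, cayleyMenger_det_eq_gram_det, ← det_sq_eq_gram_det,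
    hV, div_pow, sq_abs]
  ring
end
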